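/- Let n ≥ 3 and s ≥ 1. The set of conformal Killing s-tensors on ℝⁿ is a real vector subspace of the space of smooth symmetric trace-free s-tensor fields on ℝⁿ, and its dimension equals ((n+s−3)! (n+s−2)! (n+2s−2)(n+2s−1)(n+2s)) / (s! (s+1)! (n−2)! n!). -/

import Mathlib

/-- Partial derivative in the `a`-th coordinate direction. -/
noncomputable def pd {n : ℕ} (a : Fin n) (f : (Fin n → ℝ) → ℝ) : (Fin n → ℝ) → ℝ :=
  fun x => fderiv ℝ f x (Pi.single a (1 : ℝ))

/-- A smooth field of symmetric trace-free `s`-tensors on ℝⁿ. -/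
def IsSTF (n s : ℕ) (V : (Fin n → ℝ) → (Fin s → Fin n) → ℝ) : Prop :=
  (∀ b, ContDiff ℝ (⊤ : ℕ∞) fun x => V x b) ∧
  (∀ (x : Fin n → ℝ) (σ : Equiv.Perm (Fin s)) (b : Fin s → Fin n), V x (b ∘ σ) = V x b) ∧
  (∀ (x : Fin n → ℝ) (i j : Fin s), i ≠ j → ∀ b : Fin s → Fin n,
    ∑ e : Fin n, V x (Function.update (Function.update b i e) j e) = 0)

/-- The divergence `w^{b₂⋯b_s} = Σ_e ∂_e V^{e b₂⋯b_s}` of an `s`-tensor field. -/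
noncomputable def divT (n s : ℕ) (V : (Fin n → ℝ) → (Fin s → Fin n) → ℝ)
    (x : Fin n → ℝ) (b : Fin (s - 1) → Fin n) : ℝ :=
  ∑ e : Fin n, pd e (fun y => V y fun j =>
    if h : (j : ℕ) = 0 then e else b ⟨(j : ℕ) - 1, by have := j.isLt; omega⟩) x

/-- A conformal Killing `s`-tensor on ℝⁿ. -/
def IsCKT (n s : ℕ) (V : (Fin n → ℝ) → (Fin s → Fin n) → ℝ) : Prop :=
  IsSTF n s V ∧
  ∀ (x : Fin n → ℝ) (c : Fin (s + 1) → Fin n),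
    ∑ σ : Equiv.Perm (Fin (s + 1)),
        pd (c (σ 0)) (fun y => V y fun i => c (σ i.succ)) x
      = (s : ℝ) / ((n : ℝ) + 2 * s - 2) *
        ∑ σ : Equiv.Perm (Fin (s + 1)),
          (if c (σ 0) = c (σ 1) then (1 : ℝ) else 0) *
            divT n s V x fun i => c (σ ⟨(i : ℕ) + 2, by have := i.isLt; omega⟩)

namespace ConformalKilling

open MvPolynomial

section Fischer

variable {σ : Type*}

/-- The Fischer inner product on real polynomials, for which multiplication by a variable
is adjoint to the corresponding partial derivative. -/
noncomputable def fischer : MvPolynomial σ ℝ →ₗ[ℝ] MvPolynomial σ ℝ →ₗ[ℝ] ℝ :=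
  (basisMonomials σ ℝ).constr ℝ fun m => (m.prod fun _ k => (k.factorial : ℝ)) • lcoeff ℝ m

theorem fischer_monomial (m : σ →₀ ℕ) (r : ℝ) (g : MvPolynomial σ ℝ) :
    fischer (monomial m r) g = r * (m.prod fun _ k => (k.factorial : ℝ)) * coeff m g := by
  have h : monomial m r = r • basisMonomials σ ℝ m := by
    simp [coe_basisMonomials, smul_monomial]
  rw [h, map_smul, fischer, Module.Basis.constr_basis]
  simp [mul_assoc]

theorem fischer_X_mul (i : σ) (f g : MvPolynomial σ ℝ) :
    fischer (X i * f) g = fischer f (pderiv i g) := by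
  induction f using MvPolynomial.induction_on' with
  | add p q hp hq => simp [mul_add, hp, hq]
  | monomial m r =>
    classical
    rw [mul_comm, X, monomial_mul, mul_one, fischer_monomial, fischer_monomial, coeff_pderiv]
    have h : ((m + Finsupp.single i 1).prod fun _ k => (k.factorial : ℝ)) =
        (m i + 1) * m.prod fun _ k => (k.factorial : ℝ) := by
      have hs : m.support ⊆ insert i m.support := Finset.subset_insert _ _
      have hs' : (m + Finsupp.single i 1).support ⊆ insert i m.support := by
        intro j hj
        by_cases hji : j = i
        · simp [hji]
        · simp only [Finsupp.mem_support_iff, Finsupp.add_apply, ne_eq] at hj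
          simp only [Finset.mem_insert, Finsupp.mem_support_iff]
          right
          simpa [Finsupp.single_apply, Ne.symm hji] using hj
      rw [Finsupp.prod_of_support_subset _ hs _ (by simp),
        Finsupp.prod_of_support_subset _ hs' _ (by simp),
        ← Finset.mul_prod_erase _ _ (Finset.mem_insert_self i _),
        ← Finset.mul_prod_erase (insert i m.support) _ (Finset.mem_insert_self i _), ← mul_assoc]
      congr 1
      · simp [Nat.factorial_succ]
      · refine Finset.prod_congr rfl fun j hj => ?_
        simp [(Finset.ne_of_mem_erase hj).symm]
    rw [h]; ring

theorem fischer_self (f : MvPolynomial σ ℝ) : fischer f f =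
    ∑ m ∈ f.support, (m.prod fun _ k => (k.factorial : ℝ)) * coeff m f ^ 2 := by
  conv_lhs => enter [1]; rw [f.as_sum]
  rw [map_sum, LinearMap.sum_apply]
  exact Finset.sum_congr rfl fun m _ => by rw [fischer_monomial]; ring

theorem fischer_comm (f g : MvPolynomial σ ℝ) : fischer f g = fischer g f := by
  classical
  induction f using MvPolynomial.induction_on' with
  | add p q hp hq => simp [hp, hq]
  | monomial m r =>
    induction g using MvPolynomial.induction_on' with
    | add p q hp hq => simp [hp, hq]
    | monomial m' r' =>
      rw [fischer_monomial, fischer_monomial, coeff_monomial, coeff_monomial]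
      by_cases h : m = m'
      · subst h; simp; ring
      · simp [h, Ne.symm h]

theorem prod_factorial_pos (m : σ →₀ ℕ) : 0 < m.prod fun _ k => (k.factorial : ℝ) :=
  Finset.prod_pos fun _ _ => by positivity

theorem fischer_self_nonneg (f : MvPolynomial σ ℝ) : 0 ≤ fischer f f := by
  rw [fischer_self]
  exact Finset.sum_nonneg fun m _ => mul_nonneg (prod_factorial_pos m).le (sq_nonneg _)

theorem eq_zero_of_fischer_self {f : MvPolynomial σ ℝ} (h : fischer f f = 0) : f = 0 := by
  rw [fischer_self, Finset.sum_eq_zero_iff_of_nonneg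
    fun m _ => mul_nonneg (prod_factorial_pos m).le (sq_nonneg _)] at h
  ext m
  by_cases hm : m ∈ f.support
  · simpa [(prod_factorial_pos m).ne'] using h m hm
  · simpa using hm

end Fischer

section Operators

variable {n : ℕ}

/-- Polynomials in a point `x` (left variables) and a covector `y` (right variables). -/
abbrev PolyXY (n : ℕ) := MvPolynomial (Fin n ⊕ Fin n) ℝ

/-- The `x`-`y`-bidegree of the variables. -/
def wt (n : ℕ) : Fin n ⊕ Fin n → ℤ × ℤ := Sum.elim (fun _ => (1, 0)) fun _ => (0, 1)

/-- Polynomials homogeneous of bidegree `k`. -/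
abbrev bihom (n : ℕ) (k : ℤ × ℤ) : Submodule ℝ (PolyXY n) :=
  weightedHomogeneousSubmodule ℝ (wt n) k

/-- `|x|²`. -/
noncomputable def normX (n : ℕ) : PolyXY n := ∑ i, X (Sum.inl i) ^ 2

/-- `|y|²`. -/
noncomputable def normY (n : ℕ) : PolyXY n := ∑ i, X (Sum.inr i) ^ 2

/-- `x · y`. -/
noncomputable def dotXY (n : ℕ) : PolyXY n := ∑ i, X (Sum.inl i) * X (Sum.inr i)

/-- The derivation `y · ∂ₓ`. -/
noncomputable def dyx (n : ℕ) : Derivation ℝ (PolyXY n) (PolyXY n) :=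
  mkDerivation ℝ (Sum.elim (fun i => X (Sum.inr i)) 0)

/-- The derivation `x · ∂_y`. -/
noncomputable def dxy (n : ℕ) : Derivation ℝ (PolyXY n) (PolyXY n) :=
  mkDerivation ℝ (Sum.elim 0 fun i => X (Sum.inl i))

/-- The Laplacian in `y`. -/
noncomputable def lapY (n : ℕ) : PolyXY n →ₗ[ℝ] PolyXY n :=
  ∑ i, (pderiv (Sum.inr i)).toLinearMap ∘ₗ (pderiv (Sum.inr i)).toLinearMap

theorem lapY_apply (f : PolyXY n) :
    lapY n f = ∑ i, pderiv (Sum.inr i) (pderiv (Sum.inr i) f) := by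
  simp [lapY]

theorem sum_derivation_apply {ι : Type*} (s : Finset ι)
    (D : ι → Derivation ℝ (PolyXY n) (PolyXY n)) (f : PolyXY n) :
    (∑ i ∈ s, D i) f = ∑ i ∈ s, D i f := by
  rw [← Derivation.coeFnAddMonoidHom_apply, map_sum, Finset.sum_apply]
  rfl

theorem dyx_X_inl (i : Fin n) : dyx n (X (Sum.inl i)) = X (Sum.inr i) := by simp [dyx]

theorem dyx_X_inr (i : Fin n) : dyx n (X (Sum.inr i)) = 0 := by simp [dyx]

theorem dyx_apply (f : PolyXY n) :
    dyx n f = ∑ i, X (Sum.inr i) * pderiv (Sum.inl i) f := by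
  have h : dyx n = ∑ i, (X (Sum.inr i) : PolyXY n) • pderiv (R := ℝ) (Sum.inl i) := by
    refine derivation_ext fun j => ?_
    rcases j with j | j <;> simp [dyx, sum_derivation_apply, pderiv_X, Pi.single_apply]
  rw [h]
  simp [sum_derivation_apply]

theorem dxy_apply (f : PolyXY n) :
    dxy n f = ∑ i, X (Sum.inl i) * pderiv (Sum.inr i) f := by
  have h : dxy n = ∑ i, (X (Sum.inl i) : PolyXY n) • pderiv (R := ℝ) (Sum.inr i) := by
    refine derivation_ext fun j => ?_
    rcases j with j | j <;> simp [dxy, sum_derivation_apply, pderiv_X, Pi.single_apply]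
  rw [h]
  simp [sum_derivation_apply]

theorem dyx_normY : dyx n (normY n) = 0 := by
  simp [normY, dyx_X_inr, pow_two]

theorem dyx_normX : dyx n (normX n) = 2 * dotXY n := by
  simp only [normX, dotXY, pow_two, map_sum, Derivation.leibniz, dyx_X_inl, smul_eq_mul,
    Finset.mul_sum]
  exact Finset.sum_congr rfl fun i _ => by ring

theorem dyx_dotXY : dyx n (dotXY n) = normY n := by
  simp only [normY, dotXY, map_sum, Derivation.leibniz, dyx_X_inl, dyx_X_inr, smul_eq_mul]
  exact Finset.sum_congr rfl fun i _ => by ring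

theorem pderiv_comm {σ : Type*} (i j : σ) (f : MvPolynomial σ ℝ) :
    pderiv i (pderiv j f) = pderiv j (pderiv i f) := by
  classical
  ext m
  simp only [coeff_pderiv]
  by_cases h : i = j
  · rw [h]
  · simp only [add_right_comm m (Finsupp.single i 1), Finsupp.add_apply, Finsupp.single_apply, h,
      Ne.symm h, if_false]
    push_cast
    ring

theorem fischer_normY_mul (f g : PolyXY n) : fischer (normY n * f) g = fischer f (lapY n g) := by
  simp only [normY, lapY_apply, Finset.sum_mul, map_sum, LinearMap.sum_apply, pow_two, mul_assoc,
    fischer_X_mul]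

theorem fischer_dyx (f g : PolyXY n) : fischer (dyx n f) g = fischer f (dxy n g) := by
  simp only [dyx_apply, dxy_apply, map_sum, LinearMap.sum_apply, fischer_X_mul]
  refine Finset.sum_congr rfl fun i _ => ?_
  rw [fischer_comm, ← fischer_X_mul, fischer_comm]

theorem weight_wt (m : Fin n ⊕ Fin n →₀ ℕ) : Finsupp.weight (wt n) m =
    (∑ i, (m (Sum.inl i) : ℤ), ∑ i, (m (Sum.inr i) : ℤ)) := by
  rw [Finsupp.weight_apply, Finsupp.sum_fintype _ _ (by simp), Fintype.sum_sum_type]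
  ext <;> simp [wt, Prod.fst_sum, Prod.snd_sum]

/-- Linear maps agreeing on monomials of bidegree `k` agree on all polynomials of bidegree `k`. -/
theorem eq_of_eq_monomial {M : Type*} [AddCommGroup M] [Module ℝ M] {T T' : PolyXY n →ₗ[ℝ] M}
    {k : ℤ × ℤ} (h : ∀ m r, Finsupp.weight (wt n) m = k → T (monomial m r) = T' (monomial m r))
    {f : PolyXY n} (hf : f ∈ bihom n k) : T f = T' f := by
  rw [f.as_sum, map_sum, map_sum]
  exact Finset.sum_congr rfl fun m hm => h m _ (hf (mem_support_iff.1 hm))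

theorem euler_monomial (i : Fin n ⊕ Fin n) (m : Fin n ⊕ Fin n →₀ ℕ) (r : ℝ) :
    X i * pderiv i (monomial m r) = (m i : ℝ) • monomial m r := by
  rw [X_mul_pderiv_monomial, Nat.cast_smul_eq_nsmul]

theorem euler_inl {k : ℤ × ℤ} {f : PolyXY n} (hf : f ∈ bihom n k) :
    ∑ i, X (Sum.inl i) * pderiv (Sum.inl i) f = (k.1 : ℝ) • f := by
  have := eq_of_eq_monomial (T := ∑ i, (LinearMap.mulLeft ℝ (X (Sum.inl i))) ∘ₗ
    (pderiv (R := ℝ) (Sum.inl i)).toLinearMap) (T' := (k.1 : ℝ) • LinearMap.id) (k := k) ?_ hf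
  · simpa using this
  · intro m r hm
    simp only [LinearMap.sum_apply, LinearMap.comp_apply, LinearMap.mulLeft_apply,
      Derivation.coeFn_coe, euler_monomial, ← Finset.sum_smul, LinearMap.smul_apply,
      LinearMap.id_apply]
    rw [weight_wt] at hm
    simp [← hm]

theorem euler_inr {k : ℤ × ℤ} {f : PolyXY n} (hf : f ∈ bihom n k) :
    ∑ i, X (Sum.inr i) * pderiv (Sum.inr i) f = (k.2 : ℝ) • f := by
  have := eq_of_eq_monomial (T := ∑ i, (LinearMap.mulLeft ℝ (X (Sum.inr i))) ∘ₗ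
    (pderiv (R := ℝ) (Sum.inr i)).toLinearMap) (T' := (k.2 : ℝ) • LinearMap.id) (k := k) ?_ hf
  · simpa using this
  · intro m r hm
    simp only [LinearMap.sum_apply, LinearMap.comp_apply, LinearMap.mulLeft_apply,
      Derivation.coeFn_coe, euler_monomial, ← Finset.sum_smul, LinearMap.smul_apply,
      LinearMap.id_apply]
    rw [weight_wt] at hm
    simp [← hm]

theorem dyx_dxy (f : PolyXY n) : dyx n (dxy n f) = dxy n (dyx n f) +
    (∑ i, X (Sum.inr i) * pderiv (Sum.inr i) f - ∑ i, X (Sum.inl i) * pderiv (Sum.inl i) f) := by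
  have h : ⁅dyx n, dxy n⁆ = ∑ i, (X (Sum.inr i) : PolyXY n) • pderiv (R := ℝ) (Sum.inr i) -
      ∑ i, (X (Sum.inl i) : PolyXY n) • pderiv (R := ℝ) (Sum.inl i) := by
    refine derivation_ext fun j => ?_
    rcases j with j | j <;>
      simp [dyx, dxy, Derivation.commutator_apply, sum_derivation_apply, pderiv_X, Pi.single_apply]
  have := congrArg (fun D => D f) h
  simp only [Derivation.commutator_apply, Derivation.sub_apply, sum_derivation_apply,
    Derivation.smul_apply, smul_eq_mul] at this
  rw [← this]; ring

theorem mem_bihom_pderiv_inl {k : ℤ × ℤ} {f : PolyXY n} (hf : f ∈ bihom n k) (i : Fin n) :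
    pderiv (Sum.inl i) f ∈ bihom n (k - (1, 0)) :=
  IsWeightedHomogeneous.pderiv hf (by simp [wt])

theorem mem_bihom_pderiv_inr {k : ℤ × ℤ} {f : PolyXY n} (hf : f ∈ bihom n k) (i : Fin n) :
    pderiv (Sum.inr i) f ∈ bihom n (k - (0, 1)) :=
  IsWeightedHomogeneous.pderiv hf (by simp [wt])

theorem mem_bihom_mul {k l : ℤ × ℤ} {f g : PolyXY n} (hf : f ∈ bihom n k) (hg : g ∈ bihom n l) :
    f * g ∈ bihom n (k + l) :=
  IsWeightedHomogeneous.mul hf hg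

theorem X_inl_mem_bihom (i : Fin n) : (X (Sum.inl i) : PolyXY n) ∈ bihom n (1, 0) :=
  isWeightedHomogeneous_X ..

theorem X_inr_mem_bihom (i : Fin n) : (X (Sum.inr i) : PolyXY n) ∈ bihom n (0, 1) :=
  isWeightedHomogeneous_X ..

theorem normX_mem_bihom : normX n ∈ bihom n (2, 0) :=
  Submodule.sum_mem _ fun i _ => by
    rw [pow_two]; exact mem_bihom_mul (X_inl_mem_bihom i) (X_inl_mem_bihom i)

theorem normY_mem_bihom : normY n ∈ bihom n (0, 2) :=
  Submodule.sum_mem _ fun i _ => by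
    rw [pow_two]; exact mem_bihom_mul (X_inr_mem_bihom i) (X_inr_mem_bihom i)

theorem dotXY_mem_bihom : dotXY n ∈ bihom n (1, 1) :=
  Submodule.sum_mem _ fun i _ => mem_bihom_mul (X_inl_mem_bihom i) (X_inr_mem_bihom i)

theorem dyx_mem_bihom {k : ℤ × ℤ} {f : PolyXY n} (hf : f ∈ bihom n k) :
    dyx n f ∈ bihom n (k + (-1, 1)) := by
  rw [dyx_apply]
  refine Submodule.sum_mem _ fun i _ => ?_
  convert mem_bihom_mul (X_inr_mem_bihom i) (mem_bihom_pderiv_inl hf i) using 1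
  congr 1; ext <;> simp <;> ring

theorem dxy_mem_bihom {k : ℤ × ℤ} {f : PolyXY n} (hf : f ∈ bihom n k) :
    dxy n f ∈ bihom n (k + (1, -1)) := by
  rw [dxy_apply]
  refine Submodule.sum_mem _ fun i _ => ?_
  convert mem_bihom_mul (X_inl_mem_bihom i) (mem_bihom_pderiv_inr hf i) using 1
  congr 1; ext <;> simp <;> ring

theorem lapY_mem_bihom {k : ℤ × ℤ} {f : PolyXY n} (hf : f ∈ bihom n k) :
    lapY n f ∈ bihom n (k + (0, -2)) := by
  rw [lapY_apply]
  refine Submodule.sum_mem _ fun i _ => ?_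
  convert mem_bihom_pderiv_inr (mem_bihom_pderiv_inr hf i) i using 1
  congr 1; ext <;> simp; ring

/-- The projection onto the part of bidegree `k`. -/
noncomputable abbrev comp (k : ℤ × ℤ) : PolyXY n →ₗ[ℝ] PolyXY n :=
  weightedHomogeneousComponent (wt n) k

theorem comp_mem (k : ℤ × ℤ) (f : PolyXY n) : comp k f ∈ bihom n k :=
  weightedHomogeneousComponent_mem _ _ _

theorem comp_of_mem {k : ℤ × ℤ} {f : PolyXY n} (hf : f ∈ bihom n k) (l : ℤ × ℤ) :
    comp l f = if l = k then f else 0 :=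
  weightedHomogeneousComponent_of_mem hf

/-- Linear maps shifting the bidegree commute with the projections. -/
theorem comp_shift {T : PolyXY n →ₗ[ℝ] PolyXY n} {δ : ℤ × ℤ}
    (hT : ∀ k f, f ∈ bihom n k → T f ∈ bihom n (k + δ)) (k : ℤ × ℤ) (f : PolyXY n) :
    comp (k + δ) (T f) = T (comp k f) := by
  induction f using MvPolynomial.induction_on' with
  | add p q hp hq => simp [hp, hq]
  | monomial m r =>
    have hm : monomial m r ∈ bihom n (Finsupp.weight (wt n) m) :=
      isWeightedHomogeneous_monomial _ _ _ rfl
    rw [comp_of_mem hm, comp_of_mem (hT _ _ hm)]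
    simp only [add_left_inj]
    split_ifs <;> simp

theorem comp_mul {l : ℤ × ℤ} {g : PolyXY n} (hg : g ∈ bihom n l) (k : ℤ × ℤ) (f : PolyXY n) :
    comp (k + l) (g * f) = g * comp k f :=
  comp_shift (T := LinearMap.mulLeft ℝ g)
    (fun k f hf => by rw [add_comm]; exact mem_bihom_mul hg hf) k f

theorem comp_dyx (k : ℤ × ℤ) (f : PolyXY n) : comp (k + (-1, 1)) (dyx n f) = dyx n (comp k f) :=
  comp_shift (T := (dyx n).toLinearMap) (fun _ _ hf => dyx_mem_bihom hf) k f

theorem comp_lapY (k : ℤ × ℤ) (f : PolyXY n) :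
    comp (k + (0, -2)) (lapY n f) = lapY n (comp k f) :=
  comp_shift (fun _ _ hf => lapY_mem_bihom hf) k f

theorem eq_zero_of_comp {f : PolyXY n} (h : ∀ k, comp k f = 0) : f = 0 := by
  rw [← finsum_weightedHomogeneousComponent (wt n) f]
  simp [h]

theorem bihom_eq_bot {k : ℤ × ℤ} (hk : k.1 < 0 ∨ k.2 < 0) : bihom n k = ⊥ := by
  rw [eq_bot_iff]
  intro f hf
  rw [Submodule.mem_bot, ← support_eq_empty, Finset.eq_empty_iff_forall_notMem]
  intro m hm
  have h := hf (mem_support_iff.1 hm)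
  rw [weight_wt] at h
  have h1 : 0 ≤ ∑ i, (m (Sum.inl i) : ℤ) := Finset.sum_nonneg fun _ _ => by positivity
  have h2 : 0 ≤ ∑ i, (m (Sum.inr i) : ℤ) := Finset.sum_nonneg fun _ _ => by positivity
  subst h
  simp only at hk
  omega

end Operators

section LinearAlgebra

variable {V V' : Type*} [AddCommGroup V] [Module ℝ V] [AddCommGroup V'] [Module ℝ V']

theorem finrank_map_add_finrank_inf_ker (P : Submodule ℝ V) [FiniteDimensional ℝ P]
    (T : V →ₗ[ℝ] V') : Module.finrank ℝ (P.map T) + Module.finrank ℝ ↥(P ⊓ LinearMap.ker T) =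
      Module.finrank ℝ P := by
  rw [← LinearMap.finrank_range_add_finrank_ker (T.domRestrict P), LinearMap.range_domRestrict,
    LinearMap.ker_domRestrict, ← Submodule.finrank_map_subtype_eq P, Submodule.map_comap_subtype]

theorem exists_preimage_of_injOn {P : Submodule ℝ V} [FiniteDimensional ℝ P] {T : V →ₗ[ℝ] V}
    (hT : ∀ v ∈ P, T v ∈ P) (h0 : ∀ v ∈ P, T v = 0 → v = 0) {v : V} (hv : v ∈ P) :
    ∃ u ∈ P, T u = v := by
  have hinj : Function.Injective (T.restrict hT) := by
    rw [← LinearMap.ker_eq_bot, LinearMap.ker_eq_bot']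
    intro u hu
    exact Subtype.ext (h0 u u.2 (congrArg Subtype.val hu))
  obtain ⟨u, hu⟩ := LinearMap.injective_iff_surjective.1 hinj ⟨v, hv⟩
  exact ⟨u, u.2, congrArg Subtype.val hu⟩

end LinearAlgebra

variable {n : ℕ}

theorem weight_wt_eq_iff {m : Fin n ⊕ Fin n →₀ ℕ} {a b : ℕ} :
    Finsupp.weight (wt n) m = ((a : ℤ), (b : ℤ)) ↔
      ∑ i, m (Sum.inl i) = a ∧ ∑ i, m (Sum.inr i) = b := by
  rw [weight_wt, Prod.mk.injEq]
  norm_cast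

/-- Monomials of bidegree `(a, b)` correspond to pairs of multisets of sizes `a` and `b`. -/
noncomputable def weightEquiv (n a b : ℕ) :
    {m : Fin n ⊕ Fin n →₀ ℕ | Finsupp.weight (wt n) m = ((a : ℤ), (b : ℤ))} ≃
      Sym (Fin n) a × Sym (Fin n) b :=
  Equiv.trans
    { toFun := fun m => (⟨fun i => m.1 (Sum.inl i), (weight_wt_eq_iff.1 m.2).1⟩,
        ⟨fun i => m.1 (Sum.inr i), (weight_wt_eq_iff.1 m.2).2⟩)
      invFun := fun P => ⟨Finsupp.equivFunOnFinite.symm (Sum.elim P.1.1 P.2.1),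
        weight_wt_eq_iff.2 ⟨P.1.2, P.2.2⟩⟩
      left_inv := fun m => by
        ext i
        rcases i with i | i <;> simp
      right_inv := fun P => by ext <;> simp }
    ((Sym.equivNatSumOfFintype (Fin n) a).prodCongr (Sym.equivNatSumOfFintype (Fin n) b)).symm

theorem bihom_eq_restrictSupport (k : ℤ × ℤ) :
    bihom n k = restrictSupport ℝ {m | Finsupp.weight (wt n) m = k} :=
  weightedHomogeneousSubmodule_eq_finsupp_supported ..

instance finiteDimensional_bihom (k : ℤ × ℤ) : FiniteDimensional ℝ (bihom n k) := by
  by_cases hk : k.1 < 0 ∨ k.2 < 0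
  · rw [bihom_eq_bot hk]; infer_instance
  · obtain ⟨a, ha⟩ := Int.eq_ofNat_of_zero_le (a := k.1) (by omega)
    obtain ⟨b, hb⟩ := Int.eq_ofNat_of_zero_le (a := k.2) (by omega)
    have hk' : k = ((a : ℤ), (b : ℤ)) := Prod.ext ha hb
    rw [bihom_eq_restrictSupport, hk']
    have := Finite.of_equiv _ (weightEquiv n a b).symm
    exact Module.Basis.finiteDimensional_of_finite (basisRestrictSupport ℝ _)

theorem finrank_bihom (a b : ℕ) : Module.finrank ℝ (bihom n ((a : ℤ), (b : ℤ))) =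
    n.multichoose a * n.multichoose b := by
  rw [bihom_eq_restrictSupport, Module.finrank_eq_nat_card_basis (basisRestrictSupport ℝ _),
    Nat.card_congr (weightEquiv n a b), Nat.card_prod, Nat.card_eq_fintype_card,
    Nat.card_eq_fintype_card, Sym.card_sym_eq_multichoose, Sym.card_sym_eq_multichoose,
    Fintype.card_fin]

theorem finrank_bihom_eq_zero {k : ℤ × ℤ} (hk : k.1 < 0 ∨ k.2 < 0) :
    Module.finrank ℝ (bihom n k) = 0 := by
  rw [bihom_eq_bot hk, finrank_bot]

theorem normY_ne_zero (hn : 0 < n) : normY n ≠ 0 := by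
  intro h
  have := congrArg (eval (Sum.elim 0 1)) h
  simp [normY] at this
  omega

theorem normX_ne_zero (hn : 0 < n) : normX n ≠ 0 := by
  intro h
  have := congrArg (eval (Sum.elim 1 0)) h
  simp [normX] at this
  omega

/-- Only zero is both harmonic and divisible by `|y|²`. -/
theorem eq_zero_of_normY_dvd {f : PolyXY n} (h : normY n ∣ f) (hf : lapY n f = 0) : f = 0 := by
  obtain ⟨u, hu⟩ := h
  refine eq_zero_of_fischer_self ?_
  conv_lhs => enter [1]; rw [hu]
  rw [fischer_normY_mul, hf, map_zero]

/-- Harmonic decomposition in `y`. -/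
theorem exists_harmonic_add (hn : 0 < n) {k : ℤ × ℤ} {f : PolyXY n} (hf : f ∈ bihom n k) :
    ∃ h ∈ bihom n k, ∃ u, lapY n h = 0 ∧ f = h + normY n * u := by
  obtain ⟨u, hu, huf⟩ := exists_preimage_of_injOn (P := bihom n (k + (0, -2)))
    (T := lapY n ∘ₗ LinearMap.mulLeft ℝ (normY n)) (fun v hv => by
      change lapY n (normY n * v) ∈ _
      convert lapY_mem_bihom (mem_bihom_mul normY_mem_bihom hv) using 1
      congr 1; ext <;> simp) (fun v hv h => by
      have := eq_zero_of_normY_dvd (dvd_mul_right (normY n) v) h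
      exact (mul_eq_zero.1 this).resolve_left (normY_ne_zero hn)) (lapY_mem_bihom hf)
  refine ⟨f - normY n * u, Submodule.sub_mem _ hf ?_, u, ?_, by ring⟩
  · convert mem_bihom_mul normY_mem_bihom hu using 1
    congr 1; ext <;> simp
  · rw [map_sub, ← huf]; simp

theorem exists_dyx_eq {k : ℤ × ℤ} (hk : k.1 < k.2) {g : PolyXY n} (hg : g ∈ bihom n k) :
    ∃ f ∈ bihom n (k + (1, -1)), dyx n f = g := by
  obtain ⟨u, hu, hug⟩ := exists_preimage_of_injOn (P := bihom n k)
    (T := (dyx n).toLinearMap ∘ₗ (dxy n).toLinearMap) (fun v hv => by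
      change dyx n (dxy n v) ∈ _
      convert dyx_mem_bihom (dxy_mem_bihom hv) using 1
      congr 1; ext <;> simp) (fun v hv h => by
      replace h : dyx n (dxy n v) = 0 := h
      have h1 : fischer (dxy n v) (dxy n v) = 0 := by
        rw [← fischer_dyx, h, map_zero, LinearMap.zero_apply]
      have h2 := eq_zero_of_fischer_self h1
      have h3 := dyx_dxy v
      rw [h, euler_inl hv, euler_inr hv] at h3
      have h4 := congrArg (fun p => fischer v p) h3
      simp only [map_add, map_sub, map_smul, map_zero, smul_eq_mul, ← fischer_dyx] at h4
      have h5 := fischer_self_nonneg (dyx n v)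
      have h6 := fischer_self_nonneg v
      have h7 : (k.1 : ℝ) < k.2 := by exact_mod_cast hk
      refine eq_zero_of_fischer_self ?_
      nlinarith) hg
  exact ⟨dxy n u, dxy_mem_bihom hu, hug⟩

/-- The quotient map modulo `|y|²`, as a linear map. -/
noncomputable def quotY (n : ℕ) : PolyXY n →ₗ[ℝ] PolyXY n ⧸ Ideal.span {normY n} :=
  (Ideal.Quotient.mkₐ ℝ (Ideal.span {normY n})).toLinearMap

theorem quotY_eq_zero {f : PolyXY n} : quotY n f = 0 ↔ normY n ∣ f := by
  rw [← Ideal.mem_span_singleton]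
  exact Ideal.Quotient.eq_zero_iff_mem

theorem mem_ker_quotY {f : PolyXY n} : f ∈ LinearMap.ker (quotY n) ↔ normY n ∣ f := by
  rw [LinearMap.mem_ker, quotY_eq_zero]

theorem normY_dvd_comp {f : PolyXY n} (h : normY n ∣ f) (k : ℤ × ℤ) : normY n ∣ comp k f := by
  obtain ⟨u, rfl⟩ := h
  refine ⟨comp (k - (0, 2)) u, ?_⟩
  rw [← comp_mul normY_mem_bihom, sub_add_cancel]

theorem normY_dvd_dyx {f : PolyXY n} (h : normY n ∣ f) : normY n ∣ dyx n f := by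
  obtain ⟨u, rfl⟩ := h
  rw [Derivation.leibniz, dyx_normY, smul_zero, add_zero, smul_eq_mul]
  exact dvd_mul_right _ _

/-- The number of bidegree `k` polynomials modulo `|y|²`. -/
noncomputable def quotRank (n : ℕ) (k : ℤ × ℤ) : ℕ :=
  Module.finrank ℝ ((bihom n k).map (quotY n))

theorem finrank_bihom_inf_ker (hn : 0 < n) (k : ℤ × ℤ) :
    Module.finrank ℝ ↥(bihom n k ⊓ LinearMap.ker (quotY n)) =
      Module.finrank ℝ (bihom n (k - (0, 2))) := by
  have h : bihom n k ⊓ LinearMap.ker (quotY n) =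
      (bihom n (k - (0, 2))).map (LinearMap.mulLeft ℝ (normY n)) := by
    ext f
    rw [Submodule.mem_inf, mem_ker_quotY, Submodule.mem_map]
    constructor
    · rintro ⟨hf, u, rfl⟩
      refine ⟨comp (k - (0, 2)) u, comp_mem _ _, ?_⟩
      rw [LinearMap.mulLeft_apply, ← comp_mul normY_mem_bihom, sub_add_cancel, comp_of_mem hf,
        if_pos rfl]
    · rintro ⟨u, hu, rfl⟩
      refine ⟨?_, dvd_mul_right _ _⟩
      change normY n * u ∈ _
      convert mem_bihom_mul normY_mem_bihom hu using 1
      rw [add_sub_cancel]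
  rw [h]
  refine LinearEquiv.finrank_eq (Submodule.equivMapOfInjective _ ?_ _).symm
  exact mul_right_injective₀ (normY_ne_zero hn)

theorem quotRank_add (hn : 0 < n) (k : ℤ × ℤ) :
    quotRank n k + Module.finrank ℝ (bihom n (k - (0, 2))) = Module.finrank ℝ (bihom n k) := by
  rw [← finrank_bihom_inf_ker hn, quotRank, finrank_map_add_finrank_inf_ker]

/-- Polynomials of bidegree `k` killed by `y · ∂ₓ` modulo `|y|²`. -/
noncomputable def nullInv (n : ℕ) (k : ℤ × ℤ) : Submodule ℝ (PolyXY n) :=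
  bihom n k ⊓ LinearMap.ker (quotY n ∘ₗ (dyx n).toLinearMap)

theorem mem_nullInv {k : ℤ × ℤ} {f : PolyXY n} :
    f ∈ nullInv n k ↔ f ∈ bihom n k ∧ normY n ∣ dyx n f := by
  rw [nullInv, Submodule.mem_inf, LinearMap.mem_ker, LinearMap.comp_apply, quotY_eq_zero]
  rfl

instance (k : ℤ × ℤ) : FiniteDimensional ℝ (nullInv n k) :=
  Submodule.finiteDimensional_of_le inf_le_left

/-- The dimension of the bidegree `k` null invariants modulo `|y|²`. -/
noncomputable def invRank (n : ℕ) (k : ℤ × ℤ) : ℕ :=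
  Module.finrank ℝ ((nullInv n k).map (quotY n))

theorem invRank_add (k : ℤ × ℤ) (hk : k.1 ≤ k.2 + 1) :
    invRank n k + quotRank n (k + (-1, 1)) = quotRank n k := by
  have h1 := finrank_map_add_finrank_inf_ker (bihom n k) (quotY n ∘ₗ (dyx n).toLinearMap)
  have h2 := finrank_map_add_finrank_inf_ker (bihom n k) (quotY n)
  have h3 := finrank_map_add_finrank_inf_ker (nullInv n k) (quotY n)
  have h4 : nullInv n k ⊓ LinearMap.ker (quotY n) = bihom n k ⊓ LinearMap.ker (quotY n) := by
    refine le_antisymm (inf_le_inf_right _ inf_le_left) fun f hf => ?_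
    rw [Submodule.mem_inf, mem_ker_quotY] at hf ⊢
    exact ⟨mem_nullInv.2 ⟨hf.1, normY_dvd_dyx hf.2⟩, hf.2⟩
  have h5 : (bihom n k).map (quotY n ∘ₗ (dyx n).toLinearMap) =
      (bihom n (k + (-1, 1))).map (quotY n) := by
    rw [Submodule.map_comp]
    congr 1
    ext g
    constructor
    · rintro ⟨f, hf, rfl⟩
      exact dyx_mem_bihom hf
    · intro hg
      obtain ⟨f, hf, hfg⟩ := exists_dyx_eq (by simp; omega) hg
      refine ⟨f, ?_, hfg⟩
      have hk' : k + (-1, 1) + (1, -1) = k := by ext <;> simp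
      rwa [hk'] at hf
  rw [h4] at h3
  rw [h5] at h1
  unfold invRank quotRank
  unfold nullInv at h3 ⊢
  omega

/-- Null invariants of bidegree `k` that are harmonic in `y`. -/
noncomputable def harmInv (n : ℕ) (k : ℤ × ℤ) : Submodule ℝ (PolyXY n) :=
  nullInv n k ⊓ LinearMap.ker (lapY n)

theorem mem_harmInv {k : ℤ × ℤ} {f : PolyXY n} :
    f ∈ harmInv n k ↔ (f ∈ bihom n k ∧ normY n ∣ dyx n f) ∧ lapY n f = 0 := by
  rw [harmInv, Submodule.mem_inf, mem_nullInv, LinearMap.mem_ker]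

instance (k : ℤ × ℤ) : FiniteDimensional ℝ (harmInv n k) :=
  Submodule.finiteDimensional_of_le inf_le_left

theorem exists_harmInv_add (hn : 0 < n) {k : ℤ × ℤ} {f : PolyXY n} (hf : f ∈ nullInv n k) :
    ∃ g ∈ harmInv n k, ∃ u, f = g + normY n * u := by
  obtain ⟨hf1, hf2⟩ := mem_nullInv.1 hf
  obtain ⟨g, hg, u, hlap, rfl⟩ := exists_harmonic_add hn hf1
  refine ⟨g, mem_harmInv.2 ⟨⟨hg, ?_⟩, hlap⟩, u, rfl⟩
  rw [map_add] at hf2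
  exact (dvd_add_left (normY_dvd_dyx (dvd_mul_right _ _))).1 hf2

theorem finrank_harmInv (hn : 0 < n) (k : ℤ × ℤ) :
    Module.finrank ℝ (harmInv n k) = invRank n k := by
  have h := finrank_map_add_finrank_inf_ker (harmInv n k) (quotY n)
  have h0 : harmInv n k ⊓ LinearMap.ker (quotY n) = ⊥ := by
    rw [eq_bot_iff]
    intro f hf
    rw [Submodule.mem_inf, mem_ker_quotY, mem_harmInv] at hf
    exact (Submodule.mem_bot ℝ).2 (eq_zero_of_normY_dvd hf.2 hf.1.2)
  rw [h0, finrank_bot, add_zero] at h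
  rw [← h, invRank]
  suffices h1 : (harmInv n k).map (quotY n) = (nullInv n k).map (quotY n) by rw [h1]
  refine le_antisymm (Submodule.map_mono inf_le_left) ?_
  rintro _ ⟨f, hf, rfl⟩
  obtain ⟨g, hg, u, rfl⟩ := exists_harmInv_add hn hf
  exact ⟨g, hg, by rw [map_add, quotY_eq_zero.2 (dvd_mul_right (normY n) u), add_zero]⟩

section Regular

open Polynomial in
theorem of_mul_eq_zero {R : Type*} [CommRing R] {p : R[X]} (hp : p.Monic) {r : R}
    (hr : ∀ u, r * u = 0 → u = 0) {z : AdjoinRoot p} (hz : AdjoinRoot.of p r * z = 0) : z = 0 := by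
  rcases subsingleton_or_nontrivial R with h | h
  · rw [Subsingleton.elim r 1] at hz
    simpa using hz
  obtain ⟨f, rfl⟩ := AdjoinRoot.mk_surjective z
  have h1 : AdjoinRoot.mk p f = AdjoinRoot.mk p (f %ₘ p) := by
    rw [AdjoinRoot.mk_eq_mk]
    exact ⟨f /ₘ p, by linear_combination -(Polynomial.modByMonic_add_div f p)⟩
  rw [h1] at hz ⊢
  rw [← AdjoinRoot.mk_C, ← map_mul, AdjoinRoot.mk_eq_zero] at hz
  have h2 : Polynomial.C r * (f %ₘ p) = 0 := by
    by_contra h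
    refine hp.not_dvd_of_degree_lt h (lt_of_le_of_lt ?_ (Polynomial.degree_modByMonic_lt f hp)) hz
    rw [← Polynomial.smul_eq_C_mul]
    exact Polynomial.degree_smul_le _ _
  have h3 : f %ₘ p = 0 := by
    ext i
    have := congrArg (fun q => Polynomial.coeff q i) h2
    rw [Polynomial.coeff_C_mul, Polynomial.coeff_zero] at this
    simpa using hr _ this
  rw [h3, map_zero]

/-- On the common null cone of `|x|²` and `|y|²`, `x · y` is a nonzerodivisor. -/
theorem mem_span_of_dotXY_mul_mem {m : ℕ} (hm : 2 ≤ m) {h : PolyXY (m + 1)}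
    (hh : dotXY (m + 1) * h ∈ Ideal.span {normX (m + 1), normY (m + 1)}) :
    h ∈ Ideal.span {normX (m + 1), normY (m + 1)} := by
  set I : Ideal (PolyXY (m + 1)) := Ideal.span {normX (m + 1), normY (m + 1)} with hI
  have hXI : Ideal.Quotient.mk I (normX (m + 1)) = 0 :=
    Ideal.Quotient.eq_zero_iff_mem.2 (Ideal.subset_span (by simp))
  have hYI : Ideal.Quotient.mk I (normY (m + 1)) = 0 :=
    Ideal.Quotient.eq_zero_iff_mem.2 (Ideal.subset_span (by simp))
  let p : Polynomial (PolyXY m) := Polynomial.X ^ 2 + Polynomial.C (normX m)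
  have hp : p.Monic := Polynomial.monic_X_pow_add_C _ two_ne_zero
  have hp0 : AdjoinRoot.root p ^ 2 + AdjoinRoot.of p (normX m) = 0 := by
    simpa [p] using AdjoinRoot.eval₂_root p
  let q : Polynomial (AdjoinRoot p) :=
    Polynomial.X ^ 2 + Polynomial.C (AdjoinRoot.of p (normY m))
  have hq : q.Monic := Polynomial.monic_X_pow_add_C _ two_ne_zero
  have hq0 : AdjoinRoot.root q ^ 2 + AdjoinRoot.of q (AdjoinRoot.of p (normY m)) = 0 := by
    simpa [q] using AdjoinRoot.eval₂_root q
  let ι : PolyXY m →+* AdjoinRoot q := (AdjoinRoot.of q).comp (AdjoinRoot.of p)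
  let x0 : AdjoinRoot q := AdjoinRoot.of q (AdjoinRoot.root p)
  let y0 : AdjoinRoot q := AdjoinRoot.root q
  have hx0 : x0 ^ 2 = -ι (normX m) := by
    have := congrArg (AdjoinRoot.of q) hp0
    rw [map_add, map_pow, map_zero] at this
    exact eq_neg_of_add_eq_zero_left this
  have hy0 : y0 ^ 2 = -ι (normY m) := eq_neg_of_add_eq_zero_left hq0
  let φ : PolyXY (m + 1) →+* AdjoinRoot q := eval₂Hom (ι.comp C)
    (Sum.elim (Fin.cons x0 fun i => ι (X (Sum.inl i))) (Fin.cons y0 fun i => ι (X (Sum.inr i))))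
  have hφX : φ (normX (m + 1)) = 0 := by
    simp [φ, normX, Fin.sum_univ_succ, hx0]
  have hφY : φ (normY (m + 1)) = 0 := by
    simp [φ, normY, Fin.sum_univ_succ, hy0]
  have hφD : φ (dotXY (m + 1)) = x0 * y0 + ι (dotXY m) := by
    simp [φ, dotXY, Fin.sum_univ_succ]
  have hφI : ∀ f ∈ I, φ f = 0 := by
    intro f hf
    have : I ≤ RingHom.ker φ := by
      rw [hI, Ideal.span_le]
      rintro g (rfl | rfl)
      exacts [hφX, hφY]
    exact this hf
  let ρ : PolyXY m →+* PolyXY (m + 1) ⧸ I := (Ideal.Quotient.mk I).comp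
    (rename (R := ℝ) (Sum.map Fin.succ Fin.succ)).toRingHom
  let ψ1 : AdjoinRoot p →+* PolyXY (m + 1) ⧸ I :=
    AdjoinRoot.lift ρ (Ideal.Quotient.mk I (X (Sum.inl 0))) (by
      rw [← hXI]
      simp only [p, Polynomial.eval₂_add, Polynomial.eval₂_C, Polynomial.eval₂_pow,
        Polynomial.eval₂_X]
      simp [ρ, normX, Fin.sum_univ_succ])
  let ψ : AdjoinRoot q →+* PolyXY (m + 1) ⧸ I :=
    AdjoinRoot.lift ψ1 (Ideal.Quotient.mk I (X (Sum.inr 0))) (by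
      rw [← hYI]
      simp only [q, Polynomial.eval₂_add, Polynomial.eval₂_C, Polynomial.eval₂_pow,
        Polynomial.eval₂_X, ψ1, AdjoinRoot.lift_of]
      simp [ρ, normY, Fin.sum_univ_succ])
  have hψφ : ψ.comp φ = Ideal.Quotient.mk I := by
    refine ringHom_ext (fun r => ?_) fun i => ?_
    · simp [ψ, φ, ι, ψ1, ρ]
    · rcases i with i | i <;> induction i using Fin.cases <;>
        simp [ψ, φ, ι, ψ1, ρ, x0, y0]
  have key : ι (normX m * normY m - dotXY m ^ 2) * φ h = 0 := by
    have h1 := hφI _ hh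
    rw [map_mul, hφD] at h1
    rw [map_sub, map_mul, map_pow]
    linear_combination (x0 * y0 - ι (dotXY m)) * h1 - (φ h * y0 ^ 2) * hx0 +
      φ h * ι (normX m) * hy0
  have hD : normX m * normY m - dotXY m ^ 2 ≠ 0 := by
    intro h0
    have := congrArg (eval (Sum.elim (Pi.single (⟨0, by omega⟩ : Fin m) (1 : ℝ))
      (Pi.single (⟨1, by omega⟩ : Fin m) (1 : ℝ)))) h0
    simp [normX, normY, dotXY, Pi.single_apply] at this
  have hφh : φ h = 0 :=
    of_mul_eq_zero hq (fun u hu => of_mul_eq_zero hp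
      (fun v hv => (mul_eq_zero.1 hv).resolve_left hD) hu) key
  rw [← Ideal.Quotient.eq_zero_iff_mem, ← hψφ, RingHom.comp_apply, hφh, map_zero]

variable {n : ℕ}

theorem normY_dvd_of_comp {f : PolyXY n} (h : ∀ k, normY n ∣ comp k f) : normY n ∣ f := by
  rw [← finsum_weightedHomogeneousComponent (wt n) f]
  exact finsum_induction (fun g => normY n ∣ g) (dvd_zero _) (fun _ _ => dvd_add) h

theorem lapY_normX_mul (f : PolyXY n) : lapY n (normX n * f) = normX n * lapY n f := by
  have h (i : Fin n) : pderiv (Sum.inr i) (normX n) = 0 := by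
    simp [normX, pderiv_X]
  simp [lapY_apply, h, Finset.mul_sum]

theorem normY_dvd_of_dvd_normX_mul (hn : 0 < n) {f : PolyXY n} (h : normY n ∣ normX n * f) :
    normY n ∣ f := by
  refine normY_dvd_of_comp fun k => ?_
  obtain ⟨g, -, u, hg, hgu⟩ := exists_harmonic_add hn (comp_mem k f)
  have h1 := normY_dvd_comp h (k + (2, 0))
  rw [comp_mul normX_mem_bihom, hgu, mul_add,
    dvd_add_left ((dvd_mul_right _ _).mul_left _)] at h1
  have h2 := eq_zero_of_normY_dvd h1 (by rw [lapY_normX_mul, hg, mul_zero])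
  rw [hgu, (mul_eq_zero.1 h2).resolve_left (normX_ne_zero hn), zero_add]
  exact dvd_mul_right _ _

theorem normY_dvd_of_dvd_normX_pow_mul (hn : 0 < n) {f : PolyXY n} (k : ℕ)
    (h : normY n ∣ normX n ^ k * f) : normY n ∣ f := by
  induction k with
  | zero => simpa using h
  | succ k ih =>
    refine ih (normY_dvd_of_dvd_normX_mul hn ?_)
    rwa [← mul_assoc, ← pow_succ']

theorem exists_normX_pow_mul (hn : 3 ≤ n) (d : ℕ) (h : PolyXY n)
    (hh : normY n ∣ normX n * dyx n h - 2 * (d : PolyXY n) * dotXY n * h) :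
    ∃ g, normY n ∣ h - normX n ^ d * g ∧ normY n ∣ dyx n g := by
  induction d generalizing h with
  | zero =>
    refine ⟨h, by simp, normY_dvd_of_dvd_normX_mul (by omega) ?_⟩
    simpa using hh
  | succ d ih =>
    have h1 : h ∈ Ideal.span {normX n, normY n} := by
      obtain ⟨m, rfl⟩ : ∃ m, n = m + 1 := ⟨n - 1, by omega⟩
      refine mem_span_of_dotXY_mul_mem (by omega) ?_
      rw [Ideal.mem_span_pair]
      obtain ⟨c, hc⟩ := hh
      have hC : (C ((2 * (d + 1 : ℝ))⁻¹) : PolyXY (m + 1)) * (2 * (d + 1 : ℕ)) = 1 := by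
        have : (2 * (d + 1 : ℕ) : PolyXY (m + 1)) = C (2 * (d + 1 : ℝ)) := by
          rw [map_mul, map_add, map_ofNat, map_natCast, map_one, Nat.cast_add, Nat.cast_one]
        rw [this, ← C_mul, inv_mul_cancel₀ (by positivity), C_1]
      refine ⟨C ((2 * (d + 1 : ℝ))⁻¹) * dyx _ h, -C ((2 * (d + 1 : ℝ))⁻¹) * c, ?_⟩
      linear_combination C ((2 * (d + 1 : ℝ))⁻¹) * hc + dotXY (m + 1) * h * hC
    obtain ⟨u, v, huv⟩ := Ideal.mem_span_pair.1 h1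
    obtain ⟨g, hg1, hg2⟩ := ih u (by
      refine normY_dvd_of_dvd_normX_mul (by omega) ?_
      convert dvd_sub hh (dvd_mul_right (normY n)
        (normX n * dyx n v - 2 * ((d + 1 : ℕ) : PolyXY n) * dotXY n * v)) using 1
      simp only [← huv, map_add, Derivation.leibniz, smul_eq_mul, dyx_normX, dyx_normY]
      push_cast
      ring)
    refine ⟨g, ?_, hg2⟩
    obtain ⟨w, hw⟩ := hg1
    exact ⟨normX n * w + v, by linear_combination normX n * hw - huv⟩

end Regular

section Inversion

variable {n : ℕ}

/-- Pullback along the inversion in the unit sphere, with denominators cleared. -/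
noncomputable def invert (n : ℕ) : PolyXY n →ₐ[ℝ] PolyXY n :=
  aeval (Sum.elim (fun i => X (Sum.inl i))
    fun i => normX n * X (Sum.inr i) - 2 * dotXY n * X (Sum.inl i))

theorem invert_X_inl (i : Fin n) : invert n (X (Sum.inl i)) = X (Sum.inl i) := by simp [invert]

theorem invert_X_inr (i : Fin n) : invert n (X (Sum.inr i)) =
    normX n * X (Sum.inr i) - 2 * dotXY n * X (Sum.inl i) := by simp [invert]

theorem invert_normX : invert n (normX n) = normX n := by simp [normX, invert_X_inl]

theorem invert_dotXY : invert n (dotXY n) = -(normX n * dotXY n) := by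
  have : invert n (dotXY n) = normX n * dotXY n - 2 * dotXY n * normX n := by
    conv_lhs =>
      rw [dotXY]
      simp only [map_sum, map_mul, invert_X_inl, invert_X_inr]
    conv_rhs =>
      enter [1, 2]
      rw [dotXY]
    conv_rhs =>
      enter [2, 2]
      rw [normX]
    rw [Finset.mul_sum, Finset.mul_sum, ← Finset.sum_sub_distrib]
    exact Finset.sum_congr rfl fun i _ => by ring
  rw [this]; ring

theorem invert_normY : invert n (normY n) = normX n ^ 2 * normY n := by
  have : invert n (normY n) = normX n ^ 2 * normY n - 4 * normX n * dotXY n * dotXY n +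
      4 * dotXY n ^ 2 * normX n := by
    simp only [normY, map_sum, map_pow, invert_X_inr]
    conv_rhs =>
      enter [2]
      rw [normX, Finset.mul_sum]
    conv_rhs =>
      enter [1, 2]
      arg 2
      rw [dotXY]
    rw [Finset.mul_sum, Finset.mul_sum, ← Finset.sum_sub_distrib, ← Finset.sum_add_distrib]
    exact Finset.sum_congr rfl fun i _ => by ring
  rw [this]; ring

theorem monomial_eq_prod (m : Fin n ⊕ Fin n →₀ ℕ) (r : ℝ) : monomial m r =
    C r * ((∏ i, X (Sum.inl i) ^ m (Sum.inl i)) * ∏ i, X (Sum.inr i) ^ m (Sum.inr i)) := by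
  rw [monomial_eq, Finsupp.prod_fintype _ _ (by simp), Fintype.prod_sum_type]

theorem invert_invert {d s : ℕ} {f : PolyXY n} (hf : f ∈ bihom n ((d : ℤ), (s : ℤ))) :
    invert n (invert n f) = normX n ^ (2 * s) * f := by
  have h (i : Fin n) : invert n (invert n (X (Sum.inr i))) = normX n ^ 2 * X (Sum.inr i) := by
    rw [invert_X_inr, map_sub, map_mul, map_mul, map_mul, invert_X_inr, invert_X_inl, invert_normX,
      invert_dotXY, map_ofNat]
    ring
  refine eq_of_eq_monomial (T := (invert n).toLinearMap ∘ₗ (invert n).toLinearMap)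
    (T' := LinearMap.mulLeft ℝ (normX n ^ (2 * s))) (fun m r hm => ?_) hf
  simp only [LinearMap.comp_apply, AlgHom.toLinearMap_apply, LinearMap.mulLeft_apply]
  rw [monomial_eq_prod]
  simp only [map_mul, map_prod, map_pow, h, invert_X_inl, ← algebraMap_eq, AlgHom.commutes]
  simp only [mul_pow, Finset.prod_mul_distrib, ← pow_mul, Finset.prod_pow_eq_pow_sum,
    ← Finset.mul_sum, (weight_wt_eq_iff.1 hm).2]
  ring

theorem invert_mem_bihom {d s : ℕ} {f : PolyXY n} (hf : f ∈ bihom n ((d : ℤ), (s : ℤ))) :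
    invert n f ∈ bihom n ((d : ℤ) + 2 * s, (s : ℤ)) := by
  have hy (i : Fin n) : invert n (X (Sum.inr i)) ∈ bihom n (2, 1) := by
    rw [invert_X_inr]
    refine Submodule.sub_mem _ (mem_bihom_mul normX_mem_bihom (X_inr_mem_bihom i)) ?_
    rw [mul_assoc, ← map_ofNat C 2, C_mul']
    exact Submodule.smul_mem _ _ (mem_bihom_mul dotXY_mem_bihom (X_inl_mem_bihom i))
  rw [f.as_sum, map_sum]
  refine Submodule.sum_mem _ fun m hm => ?_
  have hm' := weight_wt_eq_iff.1 (hf (mem_support_iff.1 hm))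
  rw [monomial_eq_prod, C_mul', map_smul]
  refine Submodule.smul_mem _ _ ?_
  simp only [map_mul, map_prod, map_pow, invert_X_inl]
  convert mem_bihom_mul
    (IsWeightedHomogeneous.prod Finset.univ _ _ fun i _ =>
      (show IsWeightedHomogeneous (wt n) _ _ from X_inl_mem_bihom i).pow (m (Sum.inl i)))
    (IsWeightedHomogeneous.prod Finset.univ _ _ fun i _ =>
      (show IsWeightedHomogeneous (wt n) _ _ from hy i).pow (m (Sum.inr i))) using 2
  rw [← Finset.sum_smul, ← Finset.sum_smul, hm'.1, hm'.2]
  ext <;> simp [mul_comm]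

/-- How the inversion intertwines `y · ∂ₓ`, modulo `|y|²`. -/
theorem normY_dvd_invert_dyx {d : ℤ} {s : ℤ} {f : PolyXY n} (hf : f ∈ bihom n (d, s)) :
    normY n ∣ invert n (dyx n f) - normX n * dyx n (invert n f) +
      2 * (d : PolyXY n) * dotXY n * invert n f := by
  have key (f : PolyXY n) : normY n ∣ invert n (dyx n f) - normX n * dyx n (invert n f) +
      2 * dotXY n * invert n (∑ i, X (Sum.inl i) * pderiv (Sum.inl i) f) := by
    induction f using MvPolynomial.induction_on with
    | C r => simp [← algebraMap_eq]
    | add p q hp hq =>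
      convert dvd_add hp hq using 1
      simp only [map_add, mul_add, Finset.sum_add_distrib]
      ring
    | mul_X f i hf =>
      have h1 : ∑ j, X (Sum.inl j) * pderiv (Sum.inl j) (f * X i) =
          f * (∑ j, X (Sum.inl j) * pderiv (Sum.inl j) (X i)) +
          X i * ∑ j, X (Sum.inl j) * pderiv (Sum.inl j) f := by
        simp only [Derivation.leibniz, smul_eq_mul, Finset.mul_sum, ← Finset.sum_add_distrib]
        exact Finset.sum_congr rfl fun j _ => by ring
      have h2 : normY n ∣ invert n (dyx n (X i)) - normX n * dyx n (invert n (X i)) +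
          2 * dotXY n * invert n (∑ j, X (Sum.inl j) * pderiv (Sum.inl j) (X i)) := by
        rcases i with i | i
        · simp [dyx_X_inl, invert_X_inl, invert_X_inr, pderiv_X, Pi.single_apply]
        · refine ⟨2 * normX n * X (Sum.inl i), ?_⟩
          have h3 : ∑ j, X (Sum.inl j) * pderiv (Sum.inl j) (X (Sum.inr i) : PolyXY n) = 0 := by
            simp [pderiv_X]
          rw [h3, dyx_X_inr, invert_X_inr, map_sub, Derivation.leibniz, Derivation.leibniz,
            Derivation.leibniz, dyx_X_inl, dyx_X_inr, dyx_dotXY, dyx_normX, map_zero]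
          have h4 : dyx n 2 = 0 := by
            have := (dyx n).map_natCast 2
            exact_mod_cast this
          simp only [h4, smul_eq_mul]
          ring
      convert dvd_add (hf.mul_left (invert n (X i))) (h2.mul_left (invert n f)) using 1
      rw [h1]
      simp only [map_add, map_mul, Derivation.leibniz, smul_eq_mul]
      ring
  have := key f
  rw [euler_inl hf, map_smul, smul_eq_C_mul] at this
  convert this using 2
  simp
  ring

theorem normY_dvd_of_dvd_invert (hn : 0 < n) {d s : ℕ} {f : PolyXY n}
    (hf : f ∈ bihom n ((d : ℤ), (s : ℤ))) (h : normY n ∣ invert n f) : normY n ∣ f := by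
  refine normY_dvd_of_dvd_normX_pow_mul hn (2 * s) ?_
  rw [← invert_invert hf]
  refine dvd_trans ?_ (map_dvd (invert n) h)
  rw [invert_normY]
  exact dvd_mul_left _ _

/-- Inversion bounds the invariants in bidegree `(d, s)` by those in bidegree `(2s - d, s)`. -/
theorem finrank_harmInv_le (hn : 3 ≤ n) (d s : ℕ) :
    Module.finrank ℝ (harmInv n ((d : ℤ), (s : ℤ))) ≤
      Module.finrank ℝ (harmInv n (2 * (s : ℤ) - d, (s : ℤ))) := by
  have h0 := finrank_map_add_finrank_inf_ker (harmInv n ((d : ℤ), (s : ℤ)))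
    (quotY n ∘ₗ (invert n).toLinearMap)
  have h1 : harmInv n ((d : ℤ), (s : ℤ)) ⊓
      LinearMap.ker (quotY n ∘ₗ (invert n).toLinearMap) = ⊥ := by
    rw [eq_bot_iff]
    intro f hf
    rw [Submodule.mem_inf, mem_harmInv, LinearMap.mem_ker, LinearMap.comp_apply,
      quotY_eq_zero] at hf
    exact (Submodule.mem_bot ℝ).2
      (eq_zero_of_normY_dvd (normY_dvd_of_dvd_invert (by omega) hf.1.1.1 hf.2) hf.1.2)
  rw [h1, finrank_bot, add_zero] at h0
  rw [← h0]
  have h2 : (harmInv n ((d : ℤ), (s : ℤ))).map (quotY n ∘ₗ (invert n).toLinearMap) ≤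
      (harmInv n (2 * (s : ℤ) - d, (s : ℤ))).map
        (quotY n ∘ₗ LinearMap.mulLeft ℝ (normX n ^ d)) := by
    rintro _ ⟨f, hf, rfl⟩
    obtain ⟨⟨hf1, hf2⟩, -⟩ := mem_harmInv.1 hf
    have h3 : normY n ∣ invert n (dyx n f) := by
      refine dvd_trans ?_ (map_dvd (invert n) hf2)
      rw [invert_normY]
      exact dvd_mul_left _ _
    obtain ⟨g, hg1, hg2⟩ := exists_normX_pow_mul hn d (invert n f) (by
      convert dvd_sub h3 (normY_dvd_invert_dyx hf1) using 1
      push_cast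
      ring)
    have hX : normX n ^ d ∈ bihom n (2 * (d : ℤ), 0) := by
      have h := (show IsWeightedHomogeneous (wt n) _ _ from normX_mem_bihom).pow d
      rwa [show d • ((2 : ℤ), (0 : ℤ)) = (2 * (d : ℤ), 0) by ext <;> simp [mul_comm]] at h
    set k : ℤ × ℤ := (2 * (s : ℤ) - d, (s : ℤ)) with hk
    have h4 := normY_dvd_comp hg1 (k + (2 * (d : ℤ), 0))
    have h5 : k + (2 * (d : ℤ), 0) = ((d : ℤ) + 2 * s, (s : ℤ)) := by
      ext <;> simp [hk]; ring
    rw [map_sub, comp_mul hX, h5, comp_of_mem (invert_mem_bihom hf1), if_pos rfl] at h4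
    have h6 : comp k g ∈ nullInv n k :=
      mem_nullInv.2 ⟨comp_mem _ _, by rw [← comp_dyx]; exact normY_dvd_comp hg2 _⟩
    obtain ⟨q, hq, u, hu⟩ := exists_harmInv_add (by omega) h6
    refine ⟨q, hq, ?_⟩
    rw [hu] at h4
    change quotY n (normX n ^ d * q) = quotY n (invert n f)
    rw [← sub_eq_zero, ← map_sub, quotY_eq_zero]
    obtain ⟨w, hw⟩ := h4
    exact ⟨-w - normX n ^ d * u, by linear_combination -hw⟩
  exact (Submodule.finrank_mono h2).trans (Submodule.finrank_map_le _ _)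

theorem finrank_harmInv_symm (hn : 3 ≤ n) {d s : ℕ} (hd : d ≤ 2 * s) :
    Module.finrank ℝ (harmInv n (((2 * s - d : ℕ) : ℤ), (s : ℤ))) =
      Module.finrank ℝ (harmInv n ((d : ℤ), (s : ℤ))) := by
  have h : ((2 * s - d : ℕ) : ℤ) = 2 * s - d := by omega
  refine le_antisymm ?_ ?_
  · refine (finrank_harmInv_le hn _ _).trans_eq ?_
    rw [h, sub_sub_cancel]
  · rw [h]
    exact finrank_harmInv_le hn d s

theorem harmInv_eq_bot (hn : 3 ≤ n) {d s : ℕ} (hd : 2 * s < d) :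
    harmInv n ((d : ℤ), (s : ℤ)) = ⊥ := by
  rw [← Submodule.finrank_eq_zero (R := ℝ), ← Nat.le_zero]
  refine (finrank_harmInv_le hn d s).trans ?_
  rw [← finrank_bihom_eq_zero (n := n) (k := (2 * (s : ℤ) - d, (s : ℤ))) (by left; simp; omega)]
  exact Submodule.finrank_mono (inf_le_left.trans inf_le_left)

end Inversion

section Total

variable {n : ℕ}

/-- Polynomials homogeneous of degree `s` in `y`. -/
noncomputable def homY (n s : ℕ) : Submodule ℝ (PolyXY n) :=
  restrictSupport ℝ {m | ∑ i, m (Sum.inr i) = s}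

theorem mem_homY {s : ℕ} {f : PolyXY n} :
    f ∈ homY n s ↔ ∀ m, coeff m f ≠ 0 → ∑ i, m (Sum.inr i) = s := by
  rw [homY, mem_restrictSupport_iff]
  exact ⟨fun h m hm => h (mem_support_iff.2 hm), fun h m hm => h m (mem_support_iff.1 hm)⟩

theorem bihom_le_homY (d s : ℕ) : bihom n ((d : ℤ), (s : ℤ)) ≤ homY n s := fun _ hf =>
  mem_homY.2 fun _ hm => (weight_wt_eq_iff.1 (hf hm)).2

theorem comp_eq_zero_of_mem_homY {s : ℕ} {f : PolyXY n} (hf : f ∈ homY n s) {k : ℤ × ℤ}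
    (hk : k.2 ≠ s) : comp k f = 0 := by
  ext m
  rw [coeff_weightedHomogeneousComponent, coeff_zero]
  split_ifs with h
  · by_contra hm
    refine hk ?_
    rw [← h, weight_wt, ← mem_homY.1 hf m hm]
    simp
  · rfl

/-- The polynomials in `(x, y)` describing conformal Killing tensors. -/
noncomputable def harmTot (n s : ℕ) : Submodule ℝ (PolyXY n) :=
  homY n s ⊓ (LinearMap.ker (lapY n) ⊓ LinearMap.ker (quotY n ∘ₗ (dyx n).toLinearMap))

theorem mem_harmTot {s : ℕ} {f : PolyXY n} :
    f ∈ harmTot n s ↔ f ∈ homY n s ∧ lapY n f = 0 ∧ normY n ∣ dyx n f := by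
  rw [harmTot, Submodule.mem_inf, Submodule.mem_inf, LinearMap.mem_ker, LinearMap.mem_ker,
    LinearMap.comp_apply, quotY_eq_zero]
  rfl

theorem comp_mem_harmInv {s : ℕ} {f : PolyXY n} (hf : f ∈ harmTot n s) (k : ℤ × ℤ) :
    comp k f ∈ harmInv n k := by
  obtain ⟨-, h1, h2⟩ := mem_harmTot.1 hf
  refine mem_harmInv.2 ⟨⟨comp_mem _ _, ?_⟩, ?_⟩
  · rw [← comp_dyx]
    exact normY_dvd_comp h2 _
  · rw [← comp_lapY, h1, map_zero]

/-- The sum of bihomogeneous components. -/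
noncomputable def sumComp (n s : ℕ) :
    ((d : Fin (2 * s + 1)) → harmInv n (((d : ℕ) : ℤ), (s : ℤ))) →ₗ[ℝ] PolyXY n :=
  ∑ d : Fin (2 * s + 1), (harmInv n (((d : ℕ) : ℤ), (s : ℤ))).subtype ∘ₗ LinearMap.proj d

theorem sumComp_apply {s : ℕ}
    (g : (d : Fin (2 * s + 1)) → harmInv n (((d : ℕ) : ℤ), (s : ℤ))) :
    sumComp n s g = ∑ d, (g d : PolyXY n) := by
  simp [sumComp]

theorem comp_sumComp {s : ℕ}
    (g : (d : Fin (2 * s + 1)) → harmInv n (((d : ℕ) : ℤ), (s : ℤ))) (d : Fin (2 * s + 1)) :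
    comp (((d : ℕ) : ℤ), (s : ℤ)) (sumComp n s g) = g d := by
  rw [sumComp_apply, map_sum, Finset.sum_eq_single d]
  · rw [comp_of_mem (mem_harmInv.1 (g d).2).1.1, if_pos rfl]
  · intro e _ he
    rw [comp_of_mem (mem_harmInv.1 (g e).2).1.1, if_neg]
    simpa [Fin.ext_iff] using he.symm
  · simp

theorem range_sumComp (hn : 3 ≤ n) (s : ℕ) : LinearMap.range (sumComp n s) = harmTot n s := by
  apply le_antisymm
  · rintro _ ⟨g, rfl⟩
    rw [sumComp_apply]
    refine Submodule.sum_mem _ fun d _ => ?_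
    obtain ⟨⟨h1, h2⟩, h3⟩ := mem_harmInv.1 (g d).2
    exact mem_harmTot.2 ⟨bihom_le_homY _ _ h1, h3, h2⟩
  · intro f hf
    refine ⟨fun d => ⟨comp _ f, comp_mem_harmInv hf _⟩, ?_⟩
    rw [← sub_eq_zero]
    refine eq_zero_of_comp fun k => ?_
    rw [map_sub, sub_eq_zero]
    by_cases hk : ∃ d : Fin (2 * s + 1), k = (((d : ℕ) : ℤ), (s : ℤ))
    · obtain ⟨d, rfl⟩ := hk
      rw [comp_sumComp]
    · have h1 : comp k f = 0 := by
        by_cases hk2 : k.2 = s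
        · rcases lt_or_ge k.1 0 with hk1 | hk1
          · have := comp_mem k f
            rwa [bihom_eq_bot (Or.inl hk1), Submodule.mem_bot] at this
          · obtain ⟨d, hd⟩ := Int.eq_ofNat_of_zero_le hk1
            have hkd : k = ((d : ℤ), (s : ℤ)) := Prod.ext hd hk2
            have h2 := comp_mem_harmInv hf k
            rw [hkd, harmInv_eq_bot hn, Submodule.mem_bot] at h2
            · rwa [hkd]
            · by_contra hlt
              exact hk ⟨⟨d, by omega⟩, hkd⟩
        · exact comp_eq_zero_of_mem_homY (mem_harmTot.1 hf).1 hk2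
      rw [h1, sumComp_apply, map_sum]
      refine Finset.sum_eq_zero fun d _ => ?_
      rw [comp_of_mem (comp_mem _ _), if_neg fun h => hk ⟨d, h⟩]

theorem finrank_harmTot (hn : 3 ≤ n) (s : ℕ) : Module.finrank ℝ (harmTot n s) =
    ∑ d ∈ Finset.range (2 * s + 1), Module.finrank ℝ (harmInv n ((d : ℤ), (s : ℤ))) := by
  rw [← range_sumComp hn, LinearMap.finrank_range_of_inj, Module.finrank_pi_fintype,
    ← Fin.sum_univ_eq_sum_range
      fun d => Module.finrank ℝ (harmInv n ((d : ℤ), (s : ℤ)))]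
  intro g g' h
  funext d
  exact Subtype.ext (by rw [← comp_sumComp, h, comp_sumComp])

end Total

section Count

open Nat

theorem cast_multichoose (m a : ℕ) :
    ((m + 3).multichoose a : ℚ) = (m + 2 + a)! / (a ! * (m + 2)!) := by
  rw [Nat.multichoose_eq, show m + 3 + a - 1 = a + (m + 2) by omega, Nat.cast_choose ℚ (by omega),
    Nat.add_sub_cancel_left, add_comm a]

theorem sum_multichoose (m t : ℕ) : ∑ d ∈ Finset.range t, ((m + 3).multichoose d : ℚ) =
    t * (m + 2 + t)! / (t ! * (m + 3)!) := by
  induction t with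
  | zero => simp
  | succ t ih =>
    rw [Finset.sum_range_succ, ih, cast_multichoose, ← add_assoc, Nat.factorial_succ (m + 2 + t),
      Nat.factorial_succ t, Nat.factorial_succ (m + 2)]
    push_cast
    field_simp
    ring

/-- The dimension of the harmonic polynomials of degree `b` in `m + 3` variables. -/
noncomputable def harmDim (m b : ℕ) : ℚ := (m + 1 + 2 * b) * (m + b)! / (b ! * (m + 1)!)

theorem cast_quotRank (m a b : ℕ) :
    (quotRank (m + 3) ((a : ℤ), (b : ℤ)) : ℚ) = (m + 3).multichoose a * harmDim m b := by
  have h := quotRank_add (n := m + 3) (by omega) ((a : ℤ), (b : ℤ))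
  have h1 (c : ℕ) : (m + 2 + c)! = (m + c + 2) * ((m + c + 1) * (m + c)!) := by
    rw [show m + 2 + c = m + c + 1 + 1 by ring, Nat.factorial_succ, Nat.factorial_succ]
  rw [finrank_bihom] at h
  match b with
  | 0 =>
    rw [finrank_bihom_eq_zero (by right; simp), add_zero] at h
    rw [h]
    simp [harmDim, Nat.factorial_succ]
    field_simp
  | 1 =>
    rw [finrank_bihom_eq_zero (by right; simp), add_zero] at h
    rw [h, Nat.cast_mul]
    congr 1
    simp [harmDim, Nat.factorial_succ]
    field_simp
    ring
  | b + 2 =>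
    have h2 : ((a : ℤ), ((b + 2 : ℕ) : ℤ)) - (0, 2) = ((a : ℤ), (b : ℤ)) := by
      ext <;> simp
    rw [h2, finrank_bihom] at h
    replace h := congrArg (fun k : ℕ => (k : ℚ)) h
    push_cast at h
    push_cast
    rw [eq_sub_of_add_eq h, ← mul_sub, cast_multichoose m b, cast_multichoose m (b + 2), harmDim,
      h1, h1, ← add_assoc m b 2, Nat.factorial_succ (m + b + 1), Nat.factorial_succ (m + b),
      Nat.factorial_succ (b + 1), Nat.factorial_succ b, Nat.factorial_succ (m + 1)]
    congr 1
    push_cast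
    field_simp
    ring

theorem sum_invRank (m s t : ℕ) (ht : t ≤ s + 1) :
    ∑ d ∈ Finset.range (t + 1), (invRank (m + 3) ((d : ℤ), (s : ℤ)) : ℚ) =
      (∑ d ∈ Finset.range (t + 1), ((m + 3).multichoose d : ℚ)) * harmDim m s -
      (∑ d ∈ Finset.range t, ((m + 3).multichoose d : ℚ)) * harmDim m (s + 1) := by
  have h0 : (quotRank (m + 3) (((0 : ℕ) : ℤ) - 1, (s : ℤ) + 1)) = 0 := by
    rw [quotRank, bihom_eq_bot (by left; simp), Submodule.map_bot, finrank_bot]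
  have h (d : ℕ) (hd : d ≤ s + 1) : (invRank (m + 3) ((d : ℤ), (s : ℤ)) : ℚ) =
      (m + 3).multichoose d * harmDim m s - quotRank (m + 3) ((d : ℤ) - 1, (s : ℤ) + 1) := by
    have h1 := invRank_add (n := m + 3) ((d : ℤ), (s : ℤ)) (by simp; omega)
    rw [← cast_quotRank, ← h1]
    simp [sub_eq_add_neg]
  induction t with
  | zero =>
    rw [zero_add, Finset.sum_range_one, h 0 (by omega), h0]
    simp
  | succ t ih =>
    rw [Finset.sum_range_succ, ih (by omega), h _ ht, Finset.sum_range_succ _ (t + 1),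
      Finset.sum_range_succ _ t]
    have : ((t + 1 : ℕ) : ℤ) - 1 = t := by simp
    rw [this, ← Nat.cast_add_one s, cast_quotRank]
    ring

theorem finrank_harmTot_eq (n s : ℕ) (hn : 3 ≤ n) (hs : 1 ≤ s) :
    Module.finrank ℝ (harmTot n s) =
      (n + s - 3)! * (n + s - 2)! * (n + 2 * s - 2) * (n + 2 * s - 1) * (n + 2 * s) /
        (s ! * (s + 1)! * (n - 2)! * n !) := by
  have h1 : Module.finrank ℝ (harmTot n s) =
      ∑ d ∈ Finset.range (s + 1), invRank n ((d : ℤ), (s : ℤ)) +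
      ∑ d ∈ Finset.range s, invRank n ((d : ℤ), (s : ℤ)) := by
    rw [finrank_harmTot hn, show 2 * s + 1 = s + 1 + s by ring, Finset.sum_range_add,
      ← Finset.sum_range_reflect (fun d : ℕ => invRank n ((d : ℤ), (s : ℤ))) s]
    congr 1
    · exact Finset.sum_congr rfl fun d _ => finrank_harmInv (by omega) _
    · refine Finset.sum_congr rfl fun d hd => ?_
      rw [Finset.mem_range] at hd
      rw [← finrank_harmInv (by omega),
        ← finrank_harmInv_symm hn (show s - 1 - d ≤ 2 * s by omega),
        show 2 * s - (s - 1 - d) = s + 1 + d by omega]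
  obtain ⟨m, rfl⟩ : ∃ m, n = m + 3 := ⟨n - 3, by omega⟩
  obtain ⟨t, rfl⟩ : ∃ t, s = t + 1 := ⟨s - 1, by omega⟩
  symm
  refine Nat.div_eq_of_eq_mul_left (by positivity) ?_
  rw [h1]
  set T := ∑ d ∈ Finset.range (t + 1 + 1), invRank (m + 3) ((d : ℤ), ((t + 1 : ℕ) : ℤ)) +
    ∑ d ∈ Finset.range (t + 1), invRank (m + 3) ((d : ℤ), ((t + 1 : ℕ) : ℤ)) with hT
  have hT' : (T : ℚ) = _ := (congrArg (fun k : ℕ => (k : ℚ)) hT).trans (by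
    rw [Nat.cast_add, Nat.cast_sum, Nat.cast_sum])
  rw [← Nat.cast_inj (R := ℚ), Nat.cast_mul T, hT', sum_invRank m (t + 1) (t + 1) (by omega),
    sum_invRank m (t + 1) t (by omega), sum_multichoose, sum_multichoose, sum_multichoose,
    harmDim, harmDim,
    show m + 3 + (t + 1) - 3 = m + t + 1 by omega, show m + 3 + (t + 1) - 2 = m + t + 2 by omega,
    show m + 3 + 2 * (t + 1) - 2 = m + 2 * t + 3 by omega,
    show m + 3 + 2 * (t + 1) - 1 = m + 2 * t + 4 by omega, show m + 3 - 2 = m + 1 by omega,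
    show m + 2 + (t + 1 + 1) = m + t + 4 by ring, show m + 2 + (t + 1) = m + t + 3 by ring,
    show m + 2 + t = m + t + 2 by ring, show m + (t + 1 + 1) = m + t + 2 by ring,
    ← add_assoc m t 1]
  simp only [Nat.factorial_succ]
  push_cast
  field_simp
  ring

end Count

section Tensors

variable {n s : ℕ}

/-- Invariance of an array under permutations of its indices. -/
def IsSymmArray {M : Type*} (v : (Fin s → Fin n) → M) : Prop :=
  ∀ (σ : Equiv.Perm (Fin s)) (b : Fin s → Fin n), v (b ∘ σ) = v b

theorem IsSymmArray.cons {M : Type*} {v : (Fin (s + 1) → Fin n) → M} (hv : IsSymmArray v)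
    (a : Fin n) : IsSymmArray fun b => v (Fin.cons a b) := by
  intro σ b
  dsimp only
  rw [← hv (Equiv.Perm.decomposeFin.symm (0, σ)) (Fin.cons a b)]
  congr 1
  funext i
  refine Fin.cases ?_ (fun i => ?_) i <;> simp

theorem IsSymmArray.cons_cons {M : Type*} {v : (Fin (s + 2) → Fin n) → M} (hv : IsSymmArray v)
    (a e : Fin n) (b : Fin s → Fin n) :
    v (Fin.cons a (Fin.cons e b : Fin (s + 1) → Fin n)) =
      v (Fin.cons e (Fin.cons a b : Fin (s + 1) → Fin n)) := by
  rw [← hv (Equiv.swap 0 1)]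
  congr 1
  funext i
  refine Fin.cases ?_ (fun i => Fin.cases ?_ (fun i => ?_) i) i
  · simp
  · simp
  · have h : Equiv.swap (0 : Fin (s + 2)) 1 i.succ.succ = i.succ.succ :=
      Equiv.swap_apply_of_ne_of_ne (Fin.succ_ne_zero _)
        (by rw [← Fin.succ_zero_eq_one]; exact fun h => Fin.succ_ne_zero _ (Fin.succ_injective _ h))
    simp [h]

/-- Polynomials in `x` as polynomials in `(x, y)`. -/
noncomputable abbrev inX (n : ℕ) : MvPolynomial (Fin n) ℝ →ₐ[ℝ] PolyXY n := rename Sum.inl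

/-- The polynomial `∑ v^b y_{b₁} ⋯ y_{b_s}` of a tensor field with polynomial coefficients. -/
noncomputable def polyOf (n s : ℕ) :
    ((Fin s → Fin n) → MvPolynomial (Fin n) ℝ) →ₗ[ℝ] PolyXY n :=
  ∑ b : Fin s → Fin n, LinearMap.mulRight ℝ (∏ i, X (Sum.inr (b i))) ∘ₗ
    (inX n).toLinearMap ∘ₗ LinearMap.proj b

theorem polyOf_apply (v : (Fin s → Fin n) → MvPolynomial (Fin n) ℝ) :
    polyOf n s v = ∑ b : Fin s → Fin n, inX n (v b) * ∏ i, X (Sum.inr (b i)) := by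
  simp [polyOf]

theorem sum_cons {M : Type*} [AddCommMonoid M] (F : (Fin (s + 1) → Fin n) → M) :
    ∑ c, F c = ∑ a, ∑ b : Fin s → Fin n, F (Fin.cons a b) := by
  rw [← (Fin.consEquiv fun _ : Fin (s + 1) => Fin n).sum_comp, Fintype.sum_prod_type]
  rfl

theorem polyOf_zero (v : (Fin 0 → Fin n) → MvPolynomial (Fin n) ℝ) :
    polyOf n 0 v = inX n (v default) := by
  simp [polyOf_apply]

theorem polyOf_succ (v : (Fin (s + 1) → Fin n) → MvPolynomial (Fin n) ℝ) :
    polyOf n (s + 1) v = ∑ a, X (Sum.inr a) * polyOf n s fun b => v (Fin.cons a b) := by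
  simp only [polyOf_apply, sum_cons, Fin.prod_univ_succ, Fin.cons_zero, Fin.cons_succ,
    Finset.mul_sum]
  exact Finset.sum_congr rfl fun a _ => Finset.sum_congr rfl fun b _ => by ring

theorem pderiv_inr_inX (e : Fin n) (p : MvPolynomial (Fin n) ℝ) :
    pderiv (Sum.inr e) (inX n p) = 0 := by
  induction p using MvPolynomial.induction_on with
  | C r => simp
  | add p q hp hq => simp [hp, hq]
  | mul_X p i hp => simp [Derivation.leibniz, hp, pderiv_X]

theorem pderiv_inl_inX (e : Fin n) (p : MvPolynomial (Fin n) ℝ) :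
    pderiv (Sum.inl e) (inX n p) = inX n (pderiv e p) :=
  pderiv_rename Sum.inl_injective e p

theorem pderiv_inl_polyOf (e : Fin n) (v : (Fin s → Fin n) → MvPolynomial (Fin n) ℝ) :
    pderiv (Sum.inl e) (polyOf n s v) = polyOf n s fun b => pderiv e (v b) := by
  induction s with
  | zero => rw [polyOf_zero, polyOf_zero, pderiv_inl_inX]
  | succ s ih =>
    simp only [polyOf_succ, map_sum, Derivation.leibniz, ih]
    simp [pderiv_X]

theorem pderiv_inr_polyOf {v : (Fin (s + 1) → Fin n) → MvPolynomial (Fin n) ℝ}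
    (hv : IsSymmArray v) (e : Fin n) : pderiv (Sum.inr e) (polyOf n (s + 1) v) =
      ((s : ℝ) + 1) • polyOf n s fun b => v (Fin.cons e b) := by
  have h (w : Fin n → PolyXY n) : ∑ a, (w a * pderiv (Sum.inr e) (X (Sum.inr a) : PolyXY n)) =
      w e := by
    simp [pderiv_X, Pi.single_apply]
  induction s with
  | zero =>
    simp only [polyOf_succ, map_sum, Derivation.leibniz, smul_eq_mul, Finset.sum_add_distrib, h,
      polyOf_zero, pderiv_inr_inX]
    simp
  | succ s ih =>
    rw [polyOf_succ]
    simp only [map_sum, Derivation.leibniz, smul_eq_mul, Finset.sum_add_distrib, h,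
      ih (hv.cons _), hv.cons_cons _ e]
    rw [polyOf_succ fun b => v (Fin.cons e b)]
    simp only [mul_smul_comm, ← Finset.smul_sum]
    push_cast
    module

theorem polyOf_injOn {v : (Fin s → Fin n) → MvPolynomial (Fin n) ℝ} (hv : IsSymmArray v)
    (h : polyOf n s v = 0) : v = 0 := by
  induction s with
  | zero =>
    rw [polyOf_zero, map_eq_zero_iff _ (rename_injective _ Sum.inl_injective)] at h
    funext b
    rw [Subsingleton.elim b default, h, Pi.zero_apply]
  | succ s ih =>
    funext c
    have h1 := pderiv_inr_polyOf hv (c 0)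
    rw [h, map_zero, eq_comm, smul_eq_zero_iff_right (by positivity)] at h1
    have h2 := congrFun (ih (hv.cons _) h1) (Fin.tail c)
    rwa [Fin.cons_self_tail] at h2

theorem lapY_polyOf {v : (Fin (s + 2) → Fin n) → MvPolynomial (Fin n) ℝ} (hv : IsSymmArray v) :
    lapY n (polyOf n (s + 2) v) = (((s : ℝ) + 2) * (s + 1)) •
      polyOf n s fun b => ∑ e, v (Fin.cons e (Fin.cons e b : Fin (s + 1) → Fin n)) := by
  have h : (fun b => ∑ e, v (Fin.cons e (Fin.cons e b : Fin (s + 1) → Fin n))) =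
      ∑ e, fun b => v (Fin.cons e (Fin.cons e b : Fin (s + 1) → Fin n)) := by
    funext b; simp
  rw [h, map_sum, Finset.smul_sum, lapY_apply]
  refine Finset.sum_congr rfl fun e _ => ?_
  rw [pderiv_inr_polyOf hv, Derivation.map_smul, pderiv_inr_polyOf (hv.cons e), smul_smul]
  push_cast
  ring_nf

theorem lapY_polyOf_of_lt (hs : s < 2) (v : (Fin s → Fin n) → MvPolynomial (Fin n) ℝ) :
    lapY n (polyOf n s v) = 0 := by
  rw [lapY_apply]
  interval_cases s
  · simp [polyOf_zero, pderiv_inr_inX]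
  · refine Finset.sum_eq_zero fun e _ => ?_
    have hv : IsSymmArray v := fun σ b => by rw [Subsingleton.elim σ 1]; rfl
    rw [pderiv_inr_polyOf hv]
    simp [polyOf_zero, pderiv_inr_inX]

theorem dyx_polyOf (v : (Fin s → Fin n) → MvPolynomial (Fin n) ℝ) : dyx n (polyOf n s v) =
    polyOf n (s + 1) fun c => pderiv (c 0) (v (Fin.tail c)) := by
  simp [dyx_apply, polyOf_succ, pderiv_inl_polyOf]

theorem normY_mul_polyOf (w : (Fin s → Fin n) → MvPolynomial (Fin n) ℝ) :
    normY n * polyOf n s w =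
      polyOf n (s + 2) fun c => if c 0 = c 1 then w (Fin.tail (Fin.tail c)) else 0 := by
  have h1 (a e : Fin n) : polyOf n s (fun b => if a = e then w b else 0) =
      if a = e then polyOf n s w else 0 := by
    split_ifs
    · rfl
    · exact map_zero _
  simp [polyOf_succ, h1, normY, Finset.sum_mul, pow_two, mul_assoc]

/-- The Euler operator in `y`. -/
noncomputable def eulerY (n : ℕ) (f : PolyXY n) : PolyXY n :=
  ∑ i, X (Sum.inr i) * pderiv (Sum.inr i) f

theorem eulerY_leibniz (f g : PolyXY n) :
    eulerY n (f * g) = f * eulerY n g + g * eulerY n f := by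
  simp only [eulerY, Derivation.leibniz, smul_eq_mul, Finset.mul_sum, ← Finset.sum_add_distrib]
  exact Finset.sum_congr rfl fun i _ => by ring

theorem eulerY_sum {ι : Type*} (t : Finset ι) (f : ι → PolyXY n) :
    eulerY n (∑ i ∈ t, f i) = ∑ i ∈ t, eulerY n (f i) := by
  simp only [eulerY, map_sum, Finset.mul_sum]
  exact Finset.sum_comm

theorem eulerY_X_inr (i : Fin n) : eulerY n (X (Sum.inr i)) = X (Sum.inr i) := by
  simp [eulerY, pderiv_X, Pi.single_apply]

theorem coeff_eulerY (m : Fin n ⊕ Fin n →₀ ℕ) (f : PolyXY n) :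
    coeff m (eulerY n f) = (∑ i, (m (Sum.inr i) : ℝ)) * coeff m f := by
  induction f using MvPolynomial.induction_on' with
  | add p q hp hq =>
    have : eulerY n (p + q) = eulerY n p + eulerY n q := by
      simp [eulerY, mul_add, Finset.sum_add_distrib]
    rw [this, coeff_add, hp, hq, coeff_add, mul_add]
  | monomial k r =>
    rw [eulerY]
    simp only [euler_monomial, ← Finset.sum_smul, coeff_smul, coeff_monomial, smul_eq_mul]
    split_ifs with h
    · rw [h]
    · simp

theorem mem_homY_iff_eulerY {f : PolyXY n} : f ∈ homY n s ↔ eulerY n f = (s : ℝ) • f := by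
  rw [mem_homY, MvPolynomial.ext_iff]
  refine forall_congr' fun m => ?_
  rw [coeff_eulerY, coeff_smul, smul_eq_mul, mul_eq_mul_right_iff]
  norm_cast
  tauto

theorem eulerY_polyOf (v : (Fin s → Fin n) → MvPolynomial (Fin n) ℝ) :
    eulerY n (polyOf n s v) = (s : ℝ) • polyOf n s v := by
  induction s with
  | zero => simp [eulerY, polyOf_zero, pderiv_inr_inX]
  | succ s ih =>
    rw [polyOf_succ, eulerY_sum, Finset.smul_sum]
    refine Finset.sum_congr rfl fun a _ => ?_
    rw [eulerY_leibniz, ih, eulerY_X_inr, mul_smul_comm, mul_comm (polyOf _ _ _)]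
    push_cast
    module

theorem polyOf_mem_homY (v : (Fin s → Fin n) → MvPolynomial (Fin n) ℝ) :
    polyOf n s v ∈ homY n s :=
  mem_homY_iff_eulerY.2 (eulerY_polyOf v)

theorem pderiv_inr_mem_homY {f : PolyXY n} (hf : f ∈ homY n (s + 1)) (e : Fin n) :
    pderiv (Sum.inr e) f ∈ homY n s := by
  rw [mem_homY] at hf ⊢
  intro m hm
  rw [coeff_pderiv] at hm
  have := hf _ (left_ne_zero_of_mul hm)
  simpa [Finsupp.single_apply, Finset.sum_add_distrib] using this

theorem exists_polyOf_eq {f : PolyXY n} (hf : f ∈ homY n s) : ∃ v, polyOf n s v = f := by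
  induction s generalizing f with
  | zero =>
    obtain ⟨p, hp⟩ := exists_rename_eq_of_vars_subset_range f (Sum.inl : Fin n → _)
      Sum.inl_injective (fun i hi => by
        rcases i with i | i
        · exact ⟨i, rfl⟩
        · obtain ⟨m, hm, him⟩ := (mem_vars_iff_mem_support _).1 hi
          have := mem_homY.1 hf m (mem_support_iff.1 hm)
          rw [Finset.sum_eq_zero_iff] at this
          exact absurd (this i (Finset.mem_univ _)) (Finsupp.mem_support_iff.1 him))
    exact ⟨fun _ => p, by rw [polyOf_zero, hp]⟩
  | succ s ih =>
    choose v hv using fun a => ih (pderiv_inr_mem_homY hf a)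
    refine ⟨((s : ℝ) + 1)⁻¹ • fun c => v (c 0) (Fin.tail c), ?_⟩
    rw [map_smul, polyOf_succ]
    simp only [Fin.cons_zero, Fin.tail_cons]
    have h1 := mem_homY_iff_eulerY.1 hf
    rw [eulerY] at h1
    simp only [hv]
    rw [h1, smul_smul]
    push_cast
    rw [inv_mul_cancel₀ (by positivity), one_smul]

/-- The sum over all permutations of the indices. -/
def symmSum {M : Type*} [AddCommMonoid M] (T : (Fin s → Fin n) → M) (c : Fin s → Fin n) : M :=
  ∑ σ : Equiv.Perm (Fin s), T (c ∘ σ)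

theorem isSymmArray_symmSum {M : Type*} [AddCommMonoid M] (T : (Fin s → Fin n) → M) :
    IsSymmArray (symmSum T) := by
  intro τ b
  exact Fintype.sum_equiv (Equiv.mulLeft τ) _ _ fun σ => rfl

theorem polyOf_symmSum (T : (Fin s → Fin n) → MvPolynomial (Fin n) ℝ) :
    polyOf n s (symmSum T) = (s.factorial : ℝ) • polyOf n s T := by
  have h1 : symmSum T = ∑ σ : Equiv.Perm (Fin s), fun c => T (c ∘ σ) := by
    funext c; simp [symmSum]
  have h2 (σ : Equiv.Perm (Fin s)) : polyOf n s (fun c => T (c ∘ σ)) = polyOf n s T := by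
    rw [polyOf_apply, polyOf_apply]
    refine Fintype.sum_equiv (Equiv.arrowCongr σ.symm (Equiv.refl _)) _ _ fun c => ?_
    have h3 : Equiv.arrowCongr σ.symm (Equiv.refl (Fin n)) c = c ∘ σ := rfl
    rw [h3]
    congr 1
    exact (Equiv.prod_comp σ fun i => (X (Sum.inr (c i)) : PolyXY n)).symm
  rw [h1, map_sum, Finset.sum_congr rfl fun σ _ => h2 σ, Finset.sum_const, Finset.card_univ,
    Fintype.card_perm, Fintype.card_fin, Nat.cast_smul_eq_nsmul]

theorem exists_symm_polyOf_eq {f : PolyXY n} (hf : f ∈ homY n s) :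
    ∃ v, IsSymmArray v ∧ polyOf n s v = f := by
  obtain ⟨v, hv⟩ := exists_polyOf_eq hf
  refine ⟨(s.factorial : ℝ)⁻¹ • symmSum v, fun σ b => ?_, ?_⟩
  · rw [Pi.smul_apply, Pi.smul_apply, isSymmArray_symmSum]
  · rw [map_smul, polyOf_symmSum, smul_smul, inv_mul_cancel₀ (by positivity), one_smul, hv]

theorem symmSum_eq_smul_symmSum_iff (r : ℝ) (T U : (Fin s → Fin n) → MvPolynomial (Fin n) ℝ) :
    symmSum T = r • symmSum U ↔ polyOf n s T = r • polyOf n s U := by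
  have h0 : (s.factorial : ℝ) ≠ 0 := by positivity
  constructor
  · intro h
    have h1 := congrArg (polyOf n s) h
    rw [map_smul, polyOf_symmSum, polyOf_symmSum, smul_comm] at h1
    exact (smul_right_injective _ h0) h1
  · intro h
    rw [← sub_eq_zero]
    refine polyOf_injOn (fun σ b => ?_) ?_
    · simp only [Pi.sub_apply, Pi.smul_apply]
      rw [isSymmArray_symmSum, isSymmArray_symmSum]
    · rw [map_sub, map_smul, polyOf_symmSum, polyOf_symmSum, h, smul_comm, sub_self]

end Tensors

section Equation

variable {n s : ℕ}

/-- The mixed operator `∂ₓ · ∂_y`. -/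
noncomputable def divXY (n : ℕ) (f : PolyXY n) : PolyXY n :=
  ∑ e, pderiv (Sum.inl e) (pderiv (Sum.inr e) f)

theorem pderiv_inr_dyx (e : Fin n) (f : PolyXY n) :
    pderiv (Sum.inr e) (dyx n f) = pderiv (Sum.inl e) f + dyx n (pderiv (Sum.inr e) f) := by
  simp only [dyx_apply, map_sum, Derivation.leibniz, smul_eq_mul, Finset.sum_add_distrib,
    pderiv_comm (Sum.inr e) (Sum.inl _)]
  rw [add_comm]
  congr 1
  simp [pderiv_X, Pi.single_apply]

theorem pderiv_inr_eulerY (e : Fin n) (f : PolyXY n) :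
    pderiv (Sum.inr e) (eulerY n f) = pderiv (Sum.inr e) f + eulerY n (pderiv (Sum.inr e) f) := by
  simp only [eulerY, map_sum, Derivation.leibniz, smul_eq_mul, Finset.sum_add_distrib,
    pderiv_comm (Sum.inr e) (Sum.inr _)]
  rw [add_comm]
  congr 1
  simp [pderiv_X, Pi.single_apply]

theorem lapY_dyx (f : PolyXY n) : lapY n (dyx n f) = dyx n (lapY n f) + 2 * divXY n f := by
  simp only [lapY_apply, divXY, pderiv_inr_dyx, map_add, map_sum, Finset.sum_add_distrib,
    pderiv_comm (Sum.inr _) (Sum.inl _)]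
  ring

theorem lapY_eulerY (f : PolyXY n) :
    lapY n (eulerY n f) = eulerY n (lapY n f) + 2 * lapY n f := by
  simp only [lapY_apply, pderiv_inr_eulerY, map_add, eulerY_sum, Finset.sum_add_distrib]
  ring

theorem eulerY_dyx (f : PolyXY n) : eulerY n (dyx n f) = dyx n (eulerY n f) + dyx n f := by
  have h1 : dyx n (eulerY n f) = ∑ i, X (Sum.inr i) * dyx n (pderiv (Sum.inr i) f) := by
    simp [eulerY, dyx_X_inr]
  conv_rhs => rw [h1, dyx_apply f, ← Finset.sum_add_distrib]
  rw [eulerY]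
  exact Finset.sum_congr rfl fun i _ => by rw [pderiv_inr_dyx]; ring

theorem pderiv_inr_normY (e : Fin n) : pderiv (Sum.inr e) (normY n) = 2 * X (Sum.inr e) := by
  simp [normY, pderiv_X, Pi.single_apply]

theorem lapY_normY_mul (g : PolyXY n) : lapY n (normY n * g) =
    normY n * lapY n g + 4 * eulerY n g + 2 * (n : PolyXY n) * g := by
  have h2 (e : Fin n) : pderiv (Sum.inr e) (2 : PolyXY n) = 0 := by
    have := (pderiv (R := ℝ) (Sum.inr e : Fin n ⊕ Fin n)).map_natCast 2
    exact_mod_cast this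
  have h1 (e : Fin n) : pderiv (Sum.inr e) (pderiv (Sum.inr e) (normY n * g)) =
      normY n * pderiv (Sum.inr e) (pderiv (Sum.inr e) g) +
        4 * (X (Sum.inr e) * pderiv (Sum.inr e) g) + 2 * g := by
    simp only [Derivation.leibniz, pderiv_inr_normY, map_add, smul_eq_mul, h2, pderiv_X_self]
    ring
  simp only [lapY_apply, h1, Finset.sum_add_distrib, eulerY, Finset.mul_sum, Finset.sum_const,
    Finset.card_univ, Fintype.card_fin, nsmul_eq_mul]
  ring

theorem eulerY_normY : eulerY n (normY n) = 2 * normY n := by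
  simp only [eulerY, pderiv_inr_normY]
  rw [normY, Finset.mul_sum]
  exact Finset.sum_congr rfl fun i _ => by ring

theorem lapY_divXY (f : PolyXY n) : lapY n (divXY n f) = divXY n (lapY n f) := by
  simp only [lapY_apply, divXY, map_sum]
  refine Finset.sum_congr rfl fun e _ => Finset.sum_congr rfl fun i _ => ?_
  simp only [pderiv_comm (Sum.inr i) (Sum.inl e), pderiv_comm (Sum.inr i) (Sum.inr e)]

/-- If `|y|²` divides `(y · ∂ₓ) f` for harmonic `f`, the quotient is a multiple of the
divergence. -/
theorem smul_quotient_eq_divXY (hn : 3 ≤ n) {f g : PolyXY n} (hf : f ∈ homY n (s + 1))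
    (hlap : lapY n f = 0) (hg : dyx n f = normY n * g) :
    ((n : ℝ) + 2 * s) • g = divXY n f := by
  have hE : eulerY n g = (s : ℝ) • g := by
    have h1 := eulerY_dyx f
    rw [mem_homY_iff_eulerY.1 hf, Derivation.map_smul, hg, eulerY_leibniz, eulerY_normY] at h1
    have h2 : normY n * (eulerY n g - (s : ℝ) • g) = 0 := by
      simp only [smul_eq_C_mul] at h1 ⊢
      push_cast [map_add, map_natCast] at h1 ⊢
      simp only [C_1] at h1
      linear_combination h1
    exact sub_eq_zero.1 ((mul_eq_zero.1 h2).resolve_left (normY_ne_zero (by omega)))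
  have h1 : normY n * lapY n g + (4 * s + 2 * n : ℝ) • g = 2 * divXY n f := by
    have := lapY_dyx f
    rw [hlap, map_zero, zero_add, hg, lapY_normY_mul, hE] at this
    rw [← this]
    simp only [smul_eq_C_mul, map_add, map_mul, map_natCast, map_ofNat]
    ring
  have hE2 : eulerY n (lapY n g) = (s - 2 : ℝ) • lapY n g := by
    have := lapY_eulerY g
    rw [hE, map_smul] at this
    rw [eq_sub_of_add_eq this.symm]
    simp only [smul_eq_C_mul, map_sub, map_natCast, map_ofNat]
    ring
  have h2 : normY n * lapY n (lapY n g) = -(8 * s - 8 + 4 * n : ℝ) • lapY n g := by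
    have := congrArg (lapY n) h1
    have h0 : lapY n (2 * divXY n f) = 0 := by
      rw [two_mul, map_add, lapY_divXY, hlap]
      simp [divXY]
    rw [map_add, lapY_normY_mul, hE2, map_smul, h0] at this
    simp only [smul_eq_C_mul, map_add, map_sub, map_neg, map_mul, map_natCast, map_ofNat] at this ⊢
    linear_combination this
  have h3 : lapY n g = 0 := by
    refine eq_zero_of_fischer_self ?_
    have h4 := congrArg (fun p => fischer p (lapY n g)) h2
    simp only [fischer_normY_mul, map_smul, LinearMap.smul_apply, smul_eq_mul] at h4
    have h5 := fischer_self_nonneg (lapY n (lapY n g))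
    have h6 := fischer_self_nonneg (lapY n g)
    have h7 : (3 : ℝ) ≤ n := by exact_mod_cast hn
    have h8 : (0 : ℝ) ≤ s := s.cast_nonneg
    nlinarith
  rw [h3, mul_zero, zero_add] at h1
  have h4 : (2 : ℝ) • (((n : ℝ) + 2 * s) • g) = (2 : ℝ) • divXY n f := by
    rw [smul_smul, smul_eq_C_mul (divXY n f), map_ofNat, ← h1]
    ring_nf
  exact smul_right_injective _ two_ne_zero h4

/-- The divergence of a tensor with polynomial coefficients. -/
noncomputable def divA (v : (Fin (s + 1) → Fin n) → MvPolynomial (Fin n) ℝ)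
    (b : Fin s → Fin n) : MvPolynomial (Fin n) ℝ :=
  ∑ e, pderiv e (v (Fin.cons e b))

theorem divXY_polyOf {v : (Fin (s + 1) → Fin n) → MvPolynomial (Fin n) ℝ} (hv : IsSymmArray v) :
    divXY n (polyOf n (s + 1) v) = ((s : ℝ) + 1) • polyOf n s (divA v) := by
  have h : divA v = ∑ e, fun b => pderiv e (v (Fin.cons e b)) := by
    funext b; simp [divA]
  rw [h, map_sum, Finset.smul_sum, divXY]
  refine Finset.sum_congr rfl fun e _ => ?_
  rw [pderiv_inr_polyOf hv, Derivation.map_smul, pderiv_inl_polyOf]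

/-- The algebraic form of the conformal Killing equation. -/
theorem symmSum_eq_iff_normY_dvd (hn : 3 ≤ n)
    {v : (Fin (s + 1) → Fin n) → MvPolynomial (Fin n) ℝ} (hv : IsSymmArray v)
    (hlap : lapY n (polyOf n (s + 1) v) = 0) :
    symmSum (fun c : Fin (s + 2) → Fin n => pderiv (c 0) (v (Fin.tail c))) =
        (((s : ℝ) + 1) / (n + 2 * s)) • symmSum (fun c : Fin (s + 2) → Fin n =>
          if c 0 = c 1 then divA v (Fin.tail (Fin.tail c)) else 0) ↔
      normY n ∣ dyx n (polyOf n (s + 1) v) := by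
  have h0 : (n : ℝ) + 2 * s ≠ 0 := by
    have : (3 : ℝ) ≤ n := by exact_mod_cast hn
    positivity
  rw [symmSum_eq_smul_symmSum_iff, ← normY_mul_polyOf, ← dyx_polyOf]
  constructor
  · intro h
    exact ⟨((s + 1 : ℝ) / (n + 2 * s)) • polyOf n s (divA v), by rw [h, mul_smul_comm]⟩
  · rintro ⟨g, hg⟩
    have h1 := smul_quotient_eq_divXY hn (polyOf_mem_homY v) hlap hg
    rw [divXY_polyOf hv] at h1
    rw [hg, ← mul_smul_comm]
    congr 1
    rw [div_eq_inv_mul, mul_smul, ← h1, smul_smul, inv_mul_cancel₀ h0, one_smul]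

theorem exists_perm_zero_one {i j : Fin (s + 2)} (h : i ≠ j) :
    ∃ σ : Equiv.Perm (Fin (s + 2)), σ 0 = i ∧ σ 1 = j := by
  refine ⟨Equiv.swap (Equiv.swap 0 i 1) j * Equiv.swap 0 i, ?_, ?_⟩
  · rw [Equiv.Perm.mul_apply, Equiv.swap_apply_left, Equiv.swap_apply_of_ne_of_ne _ h]
    intro h1
    have h2 := congrArg (Equiv.swap 0 i) h1
    rw [Equiv.swap_apply_right, Equiv.swap_apply_self] at h2
    exact absurd h2 (by simp)
  · rw [Equiv.Perm.mul_apply, Equiv.swap_apply_left]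

theorem trace_free_iff {M : Type*} [AddCommMonoid M] {v : (Fin (s + 2) → Fin n) → M}
    (hv : IsSymmArray v) :
    (∀ i j : Fin (s + 2), i ≠ j → ∀ b : Fin (s + 2) → Fin n,
      ∑ e, v (Function.update (Function.update b i e) j e) = 0) ↔
    ∀ b : Fin s → Fin n, ∑ e, v (Fin.cons e (Fin.cons e b : Fin (s + 1) → Fin n)) = 0 := by
  constructor
  · intro h b
    rcases isEmpty_or_nonempty (Fin n) with hE | ⟨⟨a⟩⟩
    · simp
    rw [← h 0 1 (by simp) (Fin.cons a (Fin.cons a b : Fin (s + 1) → Fin n))]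
    refine Finset.sum_congr rfl fun e _ => congrArg v ?_
    funext k
    refine Fin.cases ?_ (fun k => Fin.cases ?_ (fun k => ?_) k) k
    · simp
    · simp
    · have h1 : k.succ.succ ≠ (1 : Fin (s + 2)) := by
        rw [← Fin.succ_zero_eq_one]; exact fun h => Fin.succ_ne_zero _ (Fin.succ_injective _ h)
      simp [h1]
  · intro h i j hij b
    obtain ⟨σ, rfl, rfl⟩ := exists_perm_zero_one hij
    rw [← h fun k => b (σ k.succ.succ)]
    refine Finset.sum_congr rfl fun e _ => ?_
    rw [← hv σ]
    congr 1
    funext k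
    refine Fin.cases ?_ (fun k => Fin.cases ?_ (fun k => ?_) k) k
    · simp
    · simp
    · have h1 : k.succ.succ ≠ (1 : Fin (s + 2)) := by
        rw [← Fin.succ_zero_eq_one]; exact fun h => Fin.succ_ne_zero _ (Fin.succ_injective _ h)
      simp [h1]

theorem trace_free_iff_lapY {v : (Fin s → Fin n) → MvPolynomial (Fin n) ℝ} (hv : IsSymmArray v) :
    (∀ i j : Fin s, i ≠ j → ∀ b : Fin s → Fin n,
      ∑ e, v (Function.update (Function.update b i e) j e) = 0) ↔
    lapY n (polyOf n s v) = 0 := by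
  rcases lt_or_ge s 2 with hs | hs
  · refine iff_of_true (fun i j hij => absurd (Fin.ext (by omega)) hij)
      (lapY_polyOf_of_lt hs v)
  · obtain ⟨s, rfl⟩ := Nat.exists_eq_add_of_le' hs
    rw [trace_free_iff hv, lapY_polyOf hv, smul_eq_zero_iff_right (by positivity)]
    constructor
    · intro h
      rw [funext h]
      exact map_zero _
    · intro h b
      exact congrFun (polyOf_injOn (fun σ b => Finset.sum_congr rfl fun e _ =>
        (hv.cons e).cons e σ b) h) b

end Equation

section Smooth

variable {n s : ℕ}

/-- The space of smooth functions on `ℝⁿ`. -/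
def Smooth (n : ℕ) : Submodule ℝ ((Fin n → ℝ) → ℝ) where
  carrier := {f | ContDiff ℝ (⊤ : ℕ∞) f}
  add_mem' hf hg := by
    rw [Set.mem_ofPred_eq] at hf hg ⊢
    exact hf.add hg
  zero_mem' := by
    rw [Set.mem_ofPred_eq]
    exact contDiff_zero_fun
  smul_mem' r f hf := by
    rw [Set.mem_ofPred_eq] at hf ⊢
    exact hf.const_smul r

theorem contDiff_smooth (g : Smooth n) : ContDiff ℝ (⊤ : ℕ∞) (g : (Fin n → ℝ) → ℝ) := g.2

theorem differentiableAt_smooth (g : Smooth n) (x : Fin n → ℝ) :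
    DifferentiableAt ℝ (g : (Fin n → ℝ) → ℝ) x :=
  ((contDiff_smooth g).differentiable (by simp)) x

/-- The partial derivative as an operator on smooth functions. -/
noncomputable def pdL (a : Fin n) : Smooth n →ₗ[ℝ] Smooth n where
  toFun g := ⟨pd a g, ((contDiff_smooth g).fderiv_right (m := (⊤ : ℕ∞)) (by simp)).clm_apply
    contDiff_const⟩
  map_add' f g := by
    ext x
    simp [pd, fderiv_add (differentiableAt_smooth f x) (differentiableAt_smooth g x)]
  map_smul' r f := by
    ext x
    simp [pd, fderiv_const_smul (differentiableAt_smooth f x) r]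

theorem pdL_apply (a : Fin n) (g : Smooth n) (x : Fin n → ℝ) :
    (pdL a g : (Fin n → ℝ) → ℝ) x = pd a g x := rfl

theorem pdL_comm (a b : Fin n) (g : Smooth n) : pdL a (pdL b g) = pdL b (pdL a g) := by
  have h (a b : Fin n) (x : Fin n → ℝ) : (pdL a (pdL b g) : (Fin n → ℝ) → ℝ) x =
      fderiv ℝ (fderiv ℝ (g : (Fin n → ℝ) → ℝ)) x (Pi.single a 1) (Pi.single b 1) := by
    have h1 : DifferentiableAt ℝ (fderiv ℝ (g : (Fin n → ℝ) → ℝ)) x :=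
      ((contDiff_smooth g).fderiv_right (m := (⊤ : ℕ∞)) (by simp)).differentiable (by simp) x
    change fderiv ℝ (fun y => fderiv ℝ (g : (Fin n → ℝ) → ℝ) y (Pi.single b 1)) x
      (Pi.single a 1) = _
    rw [fderiv_clm_apply h1 (differentiableAt_const _)]
    simp
  ext x
  rw [h, h]
  exact ((contDiff_smooth g).contDiffAt.isSymmSndFDerivAt
    (by simpa using WithTop.coe_le_coe.2 (le_top : (2 : ℕ∞) ≤ ⊤))) _ _

theorem contDiff_eval (p : MvPolynomial (Fin n) ℝ) :
    ContDiff ℝ (⊤ : ℕ∞) fun x : Fin n → ℝ => eval x p := by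
  induction p using MvPolynomial.induction_on with
  | C r =>
    simp only [eval_C]
    exact contDiff_const
  | add p q hp hq =>
    simp only [map_add]
    exact hp.add hq
  | mul_X p i hp =>
    simp only [map_mul, eval_X]
    exact hp.mul (contDiff_apply ℝ ℝ i)

/-- A polynomial as a smooth function. -/
noncomputable def evalS (n : ℕ) : MvPolynomial (Fin n) ℝ →ₗ[ℝ] Smooth n where
  toFun p := ⟨fun x => eval x p, contDiff_eval p⟩
  map_add' p q := by ext x; simp
  map_smul' r p := by ext x; simp

theorem evalS_apply (p : MvPolynomial (Fin n) ℝ) (x : Fin n → ℝ) :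
    (evalS n p : (Fin n → ℝ) → ℝ) x = eval x p := rfl

theorem evalS_injective : Function.Injective (evalS n) := fun p q h =>
  MvPolynomial.funext fun x => by rw [← evalS_apply, ← evalS_apply, h]

theorem pdL_evalS (a : Fin n) (p : MvPolynomial (Fin n) ℝ) :
    pdL a (evalS n p) = evalS n (pderiv a p) := by
  induction p using MvPolynomial.induction_on with
  | C r =>
    ext x
    have : (evalS n (C r) : (Fin n → ℝ) → ℝ) = fun _ => r := by ext; simp [evalS_apply]
    simp [pdL_apply, pd, this]
  | add p q hp hq => simp only [map_add, hp, hq]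
  | mul_X p i hp =>
    ext x
    have h1 : (evalS n (p * X i) : (Fin n → ℝ) → ℝ) =
        fun x => (evalS n p : (Fin n → ℝ) → ℝ) x * x i := by
      ext; simp [evalS_apply]
    have h2 : fderiv ℝ (evalS n p : (Fin n → ℝ) → ℝ) x (Pi.single a 1) =
        eval x (pderiv a p) := by
      rw [← evalS_apply, ← hp]; rfl
    rw [pdL_apply, pd, h1, fderiv_fun_mul (differentiableAt_smooth (evalS n p) x)
      (differentiableAt_apply i x)]
    have h3 : fderiv ℝ (fun x : Fin n → ℝ => x i) x = ContinuousLinearMap.proj i :=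
      (ContinuousLinearMap.proj (R := ℝ) (φ := fun _ : Fin n => ℝ) i).fderiv
    rw [h3, evalS_apply, evalS_apply, add_apply, smul_apply, smul_apply, h2,
      ContinuousLinearMap.proj_apply, Derivation.leibniz, pderiv_X]
    by_cases h : i = a
    · subst h; simp
    · simp [h]

/-- The homogeneous Taylor term of degree `d` at `x₀`, times `d!`. -/
noncomputable def jet (x₀ : Fin n → ℝ) : ℕ → Smooth n →ₗ[ℝ] MvPolynomial (Fin n) ℝ
  | 0 => Algebra.linearMap ℝ _ ∘ₗ LinearMap.proj x₀ ∘ₗ (Smooth n).subtype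
  | d + 1 => ∑ a, LinearMap.mulLeft ℝ (X a) ∘ₗ jet x₀ d ∘ₗ pdL a

theorem jet_zero (x₀ : Fin n → ℝ) (g : Smooth n) :
    jet x₀ 0 g = C ((g : (Fin n → ℝ) → ℝ) x₀) := rfl

theorem jet_succ (x₀ : Fin n → ℝ) (d : ℕ) (g : Smooth n) :
    jet x₀ (d + 1) g = ∑ a, X a * jet x₀ d (pdL a g) := by
  simp [jet]

theorem pderiv_jet (x₀ : Fin n → ℝ) (d : ℕ) (e : Fin n) (g : Smooth n) :
    pderiv e (jet x₀ (d + 1) g) = ((d : ℝ) + 1) • jet x₀ d (pdL e g) := by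
  have h (w : Fin n → MvPolynomial (Fin n) ℝ) : ∑ a, w a * pderiv e (X a) = w e := by
    simp [pderiv_X, Pi.single_apply]
  induction d generalizing g with
  | zero =>
    simp only [jet_succ x₀ 0, jet_zero, map_sum, Derivation.leibniz, smul_eq_mul,
      Finset.sum_add_distrib, h]
    simp
  | succ d ih =>
    rw [jet_succ]
    simp only [map_sum, Derivation.leibniz, smul_eq_mul, Finset.sum_add_distrib, h, ih,
      pdL_comm e]
    rw [jet_succ]
    simp only [mul_smul_comm, ← Finset.smul_sum]
    push_cast
    module

theorem inX_jet_mem_bihom (x₀ : Fin n → ℝ) (d : ℕ) (g : Smooth n) :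
    inX n (jet x₀ d g) ∈ bihom n ((d : ℤ), 0) := by
  induction d generalizing g with
  | zero =>
    rw [jet_zero, inX, rename_C]
    exact isWeightedHomogeneous_C _ _
  | succ d ih =>
    rw [jet_succ, map_sum]
    refine Submodule.sum_mem _ fun a _ => ?_
    rw [map_mul, inX, rename_X]
    have := mem_bihom_mul (X_inl_mem_bihom a) (ih (pdL a g))
    simpa [add_comm] using this

theorem polyOf_mem_bihom {d : ℕ} {v : (Fin s → Fin n) → MvPolynomial (Fin n) ℝ}
    (hv : ∀ b, inX n (v b) ∈ bihom n ((d : ℤ), 0)) : polyOf n s v ∈ bihom n ((d : ℤ), (s : ℤ)) := by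
  induction s with
  | zero => rw [polyOf_zero]; exact hv _
  | succ s ih =>
    rw [polyOf_succ]
    refine Submodule.sum_mem _ fun a _ => ?_
    have := mem_bihom_mul (X_inr_mem_bihom a) (ih fun b => hv (Fin.cons a b))
    simpa [add_comm] using this

theorem exists_hasDerivAt (q : MvPolynomial (Fin n) ℝ) : ∃ h : MvPolynomial (Fin n) ℝ,
    ∀ (x : Fin n → ℝ) (t : ℝ), HasDerivAt (fun t => t * eval (t • x) h) (eval (t • x) q) t := by
  induction q using MvPolynomial.induction_on' with
  | monomial m r =>
    refine ⟨monomial m (r / (m.degree + 1)), fun x t => ?_⟩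
    have h1 (r t : ℝ) : eval (t • x) (monomial m r) = t ^ m.degree * eval x (monomial m r) := by
      rw [eval_monomial, eval_monomial, Finsupp.prod, Finsupp.prod, Finsupp.degree_apply]
      simp only [Pi.smul_apply, smul_eq_mul, mul_pow, Finset.prod_mul_distrib,
        Finset.prod_pow_eq_pow_sum]
      ring
    have h0 : (m.degree : ℝ) + 1 ≠ 0 := by positivity
    simp only [h1]
    have h2 : eval x (monomial m r) = (m.degree + 1) * eval x (monomial m (r / (m.degree + 1))) := by
      rw [eval_monomial, eval_monomial]
      field_simp
    have h3 := (hasDerivAt_pow (m.degree + 1) t).mul_const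
      (eval x (monomial m (r / (m.degree + 1))))
    rw [h2]
    refine (h3.congr_deriv ?_).congr_of_eventuallyEq (Filter.Eventually.of_forall fun t => ?_)
    · simp only [Nat.cast_add, Nat.cast_one, Nat.add_sub_cancel]
      ring
    · simp only
      ring
  | add p q hp hq =>
    obtain ⟨h, hh⟩ := hp
    obtain ⟨k, hk⟩ := hq
    refine ⟨h + k, fun x t => ?_⟩
    simpa [mul_add] using (hh x t).fun_add (hk x t)

theorem mem_range_evalS_of_pdL {g : Smooth n}
    (hg : ∀ e, pdL e g ∈ LinearMap.range (evalS n)) : g ∈ LinearMap.range (evalS n) := by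
  choose q hq using hg
  choose h hh using fun e => exists_hasDerivAt (q e)
  refine ⟨C ((g : (Fin n → ℝ) → ℝ) 0) + ∑ a, X a * h a, ?_⟩
  ext x
  have hd (t : ℝ) : HasDerivAt (fun t : ℝ => (g : (Fin n → ℝ) → ℝ) (t • x) -
      ∑ a, x a * (t * eval (t • x) (h a))) 0 t := by
    have h1 : HasDerivAt (fun t : ℝ => t • x) x t := by
      simpa using (hasDerivAt_id t).smul_const x
    have h2 := (differentiableAt_smooth g (t • x)).hasFDerivAt.comp_hasDerivAt t h1
    have h3 : fderiv ℝ (g : (Fin n → ℝ) → ℝ) (t • x) x = ∑ a, x a * eval (t • x) (q a) := by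
      conv_lhs => rw [pi_eq_sum_univ' x]
      rw [map_sum]
      refine Finset.sum_congr rfl fun a _ => ?_
      rw [map_smul, smul_eq_mul, ← evalS_apply, hq, pdL_apply, pd]
      congr 3
      ext i
      simp [Pi.single_apply]
    rw [h3] at h2
    have h4 := HasDerivAt.fun_sum (u := Finset.univ) fun a _ => (hh a x t).const_mul (x a)
    rw [← sub_self (∑ a, x a * eval (t • x) (q a))]
    exact h2.fun_sub h4
  have h5 := is_const_of_deriv_eq_zero (fun t => (hd t).differentiableAt)
    (fun t => (hd t).deriv) 1 0
  simp only [one_smul, zero_smul, one_mul, zero_mul, mul_zero, Finset.sum_const_zero,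
    sub_zero] at h5
  rw [evalS_apply]
  simp only [map_add, eval_C, map_sum, map_mul, eval_X]
  linarith

theorem mem_range_evalS_of_jet {d : ℕ} {g : Smooth n} (hg : ∀ x₀, jet x₀ d g = 0) :
    g ∈ LinearMap.range (evalS n) := by
  induction d generalizing g with
  | zero =>
    have : g = 0 := by
      ext x
      simpa [jet_zero] using hg x
    rw [this]
    exact zero_mem _
  | succ d ih =>
    refine mem_range_evalS_of_pdL fun e => ih fun x₀ => ?_
    have := pderiv_jet x₀ d e g
    rw [hg, map_zero, eq_comm, smul_eq_zero_iff_right (by positivity)] at this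
    exact this

end Smooth

section Killing

variable {n s : ℕ} {M N M' N' : Type*} [AddCommGroup M] [Module ℝ M] [AddCommGroup N] [Module ℝ N]
  [AddCommGroup M'] [Module ℝ M'] [AddCommGroup N'] [Module ℝ N']

/-- Conformal Killing arrays with entries in a module, for abstract partial derivatives `D`. -/
structure IsCKArray (D : Fin n → M →ₗ[ℝ] N) (v : (Fin (s + 1) → Fin n) → M) : Prop where
  symm : IsSymmArray v
  trace_free : ∀ i j : Fin (s + 1), i ≠ j → ∀ b : Fin (s + 1) → Fin n,
    ∑ e, v (Function.update (Function.update b i e) j e) = 0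
  eq : symmSum (fun c : Fin (s + 2) → Fin n => D (c 0) (v (Fin.tail c))) =
    (((s : ℝ) + 1) / (n + 2 * s)) • symmSum (fun c : Fin (s + 2) → Fin n =>
      if c 0 = c 1 then ∑ e, D e (v (Fin.cons e (Fin.tail (Fin.tail c)))) else 0)

theorem map_symmSum (T : N →ₗ[ℝ] N') (w : (Fin s → Fin n) → N) (c : Fin s → Fin n) :
    T (symmSum w c) = symmSum (fun c => T (w c)) c := by
  simp [symmSum]

theorem IsCKArray.map {D : Fin n → M →ₗ[ℝ] N} {D' : Fin n → M' →ₗ[ℝ] N'} (T : M →ₗ[ℝ] M')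
    (T' : N →ₗ[ℝ] N') (h : ∀ e m, D' e (T m) = T' (D e m)) {v : (Fin (s + 1) → Fin n) → M}
    (hv : IsCKArray D v) : IsCKArray D' fun b => T (v b) where
  symm σ b := congrArg T (hv.symm σ b)
  trace_free i j hij b := by rw [← map_sum, hv.trace_free i j hij, map_zero]
  eq := by
    funext c
    have := congrArg T' (congrFun hv.eq c)
    rw [Pi.smul_apply, map_smul, map_symmSum, map_symmSum] at this
    simpa only [h, ← map_sum, Pi.smul_apply, apply_ite T', map_zero] using this

theorem IsCKArray.of_map {D : Fin n → M →ₗ[ℝ] N} {D' : Fin n → M' →ₗ[ℝ] N'} {T : M →ₗ[ℝ] M'}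
    (hT : Function.Injective T) {T' : N →ₗ[ℝ] N'} (hT' : Function.Injective T')
    (h : ∀ e m, D' e (T m) = T' (D e m)) {v : (Fin (s + 1) → Fin n) → M}
    (hv : IsCKArray D' fun b => T (v b)) : IsCKArray D v where
  symm σ b := hT (hv.symm σ b)
  trace_free i j hij b := hT (by rw [map_sum, hv.trace_free i j hij, map_zero])
  eq := by
    funext c
    refine hT' ?_
    have := congrFun hv.eq c
    rw [Pi.smul_apply, map_smul, map_symmSum, map_symmSum]
    simpa only [h, ← map_sum, Pi.smul_apply, apply_ite T', map_zero] using this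

theorem isCKArray_pderiv_iff (hn : 3 ≤ n) {v : (Fin (s + 1) → Fin n) → MvPolynomial (Fin n) ℝ} :
    IsCKArray (fun e => (pderiv e).toLinearMap) v ↔
      IsSymmArray v ∧ polyOf n (s + 1) v ∈ harmTot n (s + 1) := by
  rw [mem_harmTot]
  constructor
  · intro h
    have h1 := (trace_free_iff_lapY h.symm).1 h.trace_free
    exact ⟨h.symm, polyOf_mem_homY v, h1, (symmSum_eq_iff_normY_dvd hn h.symm h1).1 h.eq⟩
  · rintro ⟨h1, -, h2, h3⟩
    exact ⟨h1, (trace_free_iff_lapY h1).2 h2, (symmSum_eq_iff_normY_dvd hn h1 h2).2 h3⟩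

theorem coe_sum_smooth {ι : Type*} (t : Finset ι) (g : ι → Smooth n) (x : Fin n → ℝ) :
    ((∑ i ∈ t, g i : Smooth n) : (Fin n → ℝ) → ℝ) x = ∑ i ∈ t, (g i : (Fin n → ℝ) → ℝ) x := by
  simp

theorem divT_succ (S : (Fin (s + 1) → Fin n) → Smooth n) (x : Fin n → ℝ) (b : Fin s → Fin n) :
    divT n (s + 1) (fun x b => (S b : (Fin n → ℝ) → ℝ) x) x b =
      ((∑ e, pdL e (S (Fin.cons e b)) : Smooth n) : (Fin n → ℝ) → ℝ) x := by
  rw [coe_sum_smooth, divT]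
  refine Finset.sum_congr rfl fun e _ => ?_
  rw [pdL_apply]
  congr 1
  funext y
  refine congrArg (fun b => (S b : (Fin n → ℝ) → ℝ) y) (funext fun j => ?_)
  refine Fin.cases ?_ (fun j => ?_) j <;> simp

theorem isCKT_iff (S : (Fin (s + 1) → Fin n) → Smooth n) :
    IsCKT n (s + 1) (fun x b => (S b : (Fin n → ℝ) → ℝ) x) ↔ IsCKArray pdL S := by
  have h1 (x : Fin n → ℝ) (c : Fin (s + 2) → Fin n) :
      ∑ σ : Equiv.Perm (Fin (s + 2)),
        pd (c (σ 0)) (fun y => (S (fun i => c (σ i.succ)) : (Fin n → ℝ) → ℝ) y) x =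
      (symmSum (fun c : Fin (s + 2) → Fin n => pdL (c 0) (S (Fin.tail c))) c).1 x := by
    rw [symmSum, coe_sum_smooth]
    rfl
  have h2 (x : Fin n → ℝ) (c : Fin (s + 2) → Fin n) :
      ∑ σ : Equiv.Perm (Fin (s + 2)), (if c (σ 0) = c (σ 1) then (1 : ℝ) else 0) *
        divT n (s + 1) (fun x b => (S b : (Fin n → ℝ) → ℝ) x) x
          (fun i => c (σ ⟨(i : ℕ) + 2, by have := i.isLt; omega⟩)) =
      (symmSum (fun c : Fin (s + 2) → Fin n =>
        if c 0 = c 1 then ∑ e, pdL e (S (Fin.cons e (Fin.tail (Fin.tail c)))) else 0) c).1 x := by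
    rw [symmSum, coe_sum_smooth]
    refine Finset.sum_congr rfl fun σ _ => ?_
    rw [divT_succ, Function.comp_apply, Function.comp_apply]
    by_cases h : c (σ 0) = c (σ 1)
    · rw [if_pos h, one_mul, if_pos h]
      rfl
    · rw [if_neg h, zero_mul, if_neg h]
      rfl
  have h3 : ((s + 1 : ℕ) : ℝ) / ((n : ℝ) + 2 * (s + 1 : ℕ) - 2) = ((s : ℝ) + 1) / (n + 2 * s) := by
    push_cast
    ring_nf
  constructor
  · rintro ⟨⟨-, h4, h5⟩, h6⟩
    refine ⟨fun σ b => Subtype.ext (funext fun x => h4 x σ b), fun i j hij b => ?_, ?_⟩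
    · ext x
      rw [coe_sum_smooth]
      exact h5 x i j hij b
    · funext c
      ext x
      rw [← h1, h6, h2, h3]
      rfl
  · intro h
    refine ⟨⟨fun b => contDiff_smooth _, fun x σ b => ?_, fun x i j hij b => ?_⟩, fun x c => ?_⟩
    · dsimp only
      rw [h.symm]
    · rw [← coe_sum_smooth, h.trace_free i j hij]
      rfl
    · rw [h1, h2, h.eq, h3]
      rfl

theorem jet_eq_zero (hn : 3 ≤ n) {S : (Fin (s + 1) → Fin n) → Smooth n} (hS : IsCKArray pdL S)
    (x₀ : Fin n → ℝ) (b : Fin (s + 1) → Fin n) : jet x₀ (2 * s + 3) (S b) = 0 := by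
  have h1 : IsCKArray (fun e => (pderiv e).toLinearMap) fun b => jet x₀ (2 * s + 3) (S b) :=
    hS.map _ ((((2 * s + 2 : ℕ) : ℝ) + 1) • jet x₀ (2 * s + 2)) fun e m => pderiv_jet x₀ _ e m
  obtain ⟨h2, h3⟩ := (isCKArray_pderiv_iff hn).1 h1
  rw [mem_harmTot] at h3
  have h4 := mem_harmInv.2 ⟨⟨polyOf_mem_bihom fun b => inX_jet_mem_bihom x₀ _ (S b), h3.2.2⟩, h3.2.1⟩
  rw [harmInv_eq_bot hn (by omega), Submodule.mem_bot] at h4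
  exact congrFun (polyOf_injOn h2 h4) b

/-- Arrays of polynomials as tensor fields. -/
noncomputable def evalT (n s : ℕ) : ((Fin s → Fin n) → MvPolynomial (Fin n) ℝ) →ₗ[ℝ]
    ((Fin n → ℝ) → (Fin s → Fin n) → ℝ) where
  toFun v x b := eval x (v b)
  map_add' _ _ := by ext; simp
  map_smul' _ _ := by ext; simp

theorem evalT_injective : Function.Injective (evalT n s) := fun _ _ h =>
  funext fun b => MvPolynomial.funext fun x => congrFun (congrFun h x) b

theorem isCKT_iff_exists (hn : 3 ≤ n) (V : (Fin n → ℝ) → (Fin (s + 1) → Fin n) → ℝ) :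
    IsCKT n (s + 1) V ↔ ∃ v, (IsSymmArray v ∧ polyOf n (s + 1) v ∈ harmTot n (s + 1)) ∧
      evalT n (s + 1) v = V := by
  simp only [← isCKArray_pderiv_iff hn]
  constructor
  · intro h
    have hS := (isCKT_iff fun b => ⟨_, h.1.1 b⟩).1 h
    choose v hv using fun b => mem_range_evalS_of_jet fun x₀ => jet_eq_zero hn hS x₀ b
    refine ⟨v, ?_, ?_⟩
    · refine .of_map evalS_injective evalS_injective (fun e p => pdL_evalS e p) ?_
      simpa only [hv] using hS
    · funext x b
      exact congrFun (congrArg Subtype.val (hv b)) x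
  · rintro ⟨v, hv, rfl⟩
    exact (isCKT_iff _).2 (hv.map (evalS n) (evalS n) fun e p => pdL_evalS e p)

/-- Symmetric arrays of polynomials with prescribed generating polynomial. -/
def symmIn (P : Submodule ℝ (PolyXY n)) (s : ℕ) :
    Submodule ℝ ((Fin s → Fin n) → MvPolynomial (Fin n) ℝ) where
  carrier := {v | IsSymmArray v ∧ polyOf n s v ∈ P}
  add_mem' hv hw := ⟨fun σ b => congrArg₂ (· + ·) (hv.1 σ b) (hw.1 σ b),
    by rw [map_add]; exact add_mem hv.2 hw.2⟩
  zero_mem' := ⟨fun _ _ => rfl, by rw [map_zero]; exact zero_mem _⟩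
  smul_mem' r v hv := ⟨fun σ b => congrArg (r • ·) (hv.1 σ b),
    by rw [map_smul]; exact P.smul_mem r hv.2⟩

theorem finrank_symmIn {P : Submodule ℝ (PolyXY n)} (hP : P ≤ homY n s) :
    Module.finrank ℝ (symmIn P s) = Module.finrank ℝ P := by
  have h1 : Function.Injective ((polyOf n s).domRestrict (symmIn P s)) := by
    rw [injective_iff_map_eq_zero]
    exact fun v hv => Subtype.ext (polyOf_injOn v.2.1 hv)
  have h2 : LinearMap.range ((polyOf n s).domRestrict (symmIn P s)) = P := by
    ext f
    constructor
    · rintro ⟨v, rfl⟩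
      exact v.2.2
    · intro hf
      obtain ⟨v, hv, rfl⟩ := exists_symm_polyOf_eq (hP hf)
      exact ⟨⟨v, hv, hf⟩, rfl⟩
  rw [← LinearMap.finrank_range_of_inj h1, h2]

end Killing

end ConformalKilling

/-- For n ≥ 3 and s ≥ 1, the conformal Killing `s`-tensors on ℝⁿ form a real vector
subspace of the space of smooth symmetric trace-free `s`-tensor fields, of dimension
`(n+s−3)!(n+s−2)!(n+2s−2)(n+2s−1)(n+2s) / (s!(s+1)!(n−2)!n!)`. -/
theorem stmt_9 (n s : ℕ) (hn : 3 ≤ n) (hs : 1 ≤ s) :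
    ∃ W : Submodule ℝ ((Fin n → ℝ) → (Fin s → Fin n) → ℝ),
      (∀ V, V ∈ W ↔ IsCKT n s V) ∧
      Module.finrank ℝ W =
        Nat.factorial (n + s - 3) * Nat.factorial (n + s - 2)
            * (n + 2 * s - 2) * (n + 2 * s - 1) * (n + 2 * s)
          / (Nat.factorial s * Nat.factorial (s + 1)
              * Nat.factorial (n - 2) * Nat.factorial n) := by
  open ConformalKilling in
  refine ⟨(symmIn (harmTot n s) s).map (evalT n s), fun V => ?_, ?_⟩
  · obtain ⟨s, rfl⟩ := Nat.exists_eq_add_of_le' hs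
    rw [isCKT_iff_exists hn]
    rfl
  · rw [← (Submodule.equivMapOfInjective _ evalT_injective _).finrank_eq,
      finrank_symmIn fun f hf => (mem_harmTot.1 hf).1, finrank_harmTot_eq n s hn hs]
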